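/- arXiv:2107.09994 — 2 statements merged into one kernel-verified Lean document; each statement's English description precedes it below -/
import Mathlib

section
/- Let F be a class of simple finite graphs closed under taking subgraphs such that every graph G in F satisfies the list coloring conjecture, i.e., its edge choosability ch'(G) equals its chromatic index χ'(G). Then Hadwiger's conjecture holds for every total graph T(G) with G in F, i.e., χ(T(G)) ≤ η(T(G)). -/
open SimpleGraph

/-- The total graph `T(G)` of a simple graph `G`: its vertices are the vertices and edges
of `G`, with two elements adjacent iff they are adjacent or incident in `G`. -/
def totalGraph {V : Type*} (G : SimpleGraph V) : SimpleGraph (V ⊕ G.edgeSet) :=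
  SimpleGraph.fromRel fun x y =>
    match x, y with
    | Sum.inl u, Sum.inl v => G.Adj u v
    | Sum.inl u, Sum.inr e => u ∈ (e : Sym2 V)
    | Sum.inr e, Sum.inl u => u ∈ (e : Sym2 V)
    | Sum.inr e, Sum.inr f => ∃ u, u ∈ (e : Sym2 V) ∧ u ∈ (f : Sym2 V)

/-- `cv`, `ce` form a total coloring of `G`: adjacent vertices get distinct colors, edges
sharing an endpoint get distinct colors, and every edge gets a color distinct from the colors
of both of its endpoints. -/
def IsTotalColoring {V : Type*} (G : SimpleGraph V) (cv : V → ℕ) (ce : Sym2 V → ℕ) : Prop :=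
  (∀ ⦃u v⦄, G.Adj u v → cv u ≠ cv v) ∧
  (∀ ⦃u v w⦄, G.Adj u v → G.Adj u w → v ≠ w → ce s(u, v) ≠ ce s(u, w)) ∧
  (∀ ⦃u v⦄, G.Adj u v → ce s(u, v) ≠ cv u ∧ ce s(u, v) ≠ cv v)

/-- The total chromatic number `χ''(G)`: the least `k` such that `G` has a total coloring
using colors `0, …, k-1`. -/
noncomputable def totalChromaticNumber {V : Type*} (G : SimpleGraph V) : ℕ :=
  sInf {k | ∃ cv ce, IsTotalColoring G cv ce ∧ (∀ v, cv v < k) ∧ ∀ e ∈ G.edgeSet, ce e < k}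

/-- `H` has a minor isomorphic to `K`: there are pairwise disjoint nonempty branch sets,
one for each vertex of `K`, each inducing a connected subgraph of `H`, with an edge of `H`
between the branch sets of any two adjacent vertices of `K`. -/
def HasMinor {W U : Type*} (H : SimpleGraph W) (K : SimpleGraph U) : Prop :=
  ∃ B : U → Set W,
    (∀ i, (B i).Nonempty) ∧
    (Pairwise fun i j => Disjoint (B i) (B j)) ∧
    (∀ i, (H.induce (B i)).Connected) ∧
    ∀ ⦃i j⦄, K.Adj i j → ∃ u ∈ B i, ∃ v ∈ B j, H.Adj u v

/-- `H` has a clique minor of order `t` (a `K_t`-minor): `t` pairwise disjoint nonempty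
vertex subsets, each inducing a connected subgraph, with an edge between every pair. -/
def HasCliqueMinor {W : Type*} (H : SimpleGraph W) (t : ℕ) : Prop :=
  ∃ B : Fin t → Set W,
    (∀ i, (B i).Nonempty) ∧
    (Pairwise fun i j => Disjoint (B i) (B j)) ∧
    (∀ i, (H.induce (B i)).Connected) ∧
    Pairwise fun i j => ∃ u ∈ B i, ∃ v ∈ B j, H.Adj u v

/-- The Hadwiger number `η(H)`: the largest `t` such that `H` has a `K_t`-minor. -/
noncomputable def hadwigerNumber {W : Type*} (H : SimpleGraph W) : ℕ :=
  sSup {t | HasCliqueMinor H t}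

/-- A graph is `c`-vertex-connected if it has more than `c` vertices and deleting any set of
fewer than `c` vertices leaves a connected graph. -/
def IsKConnected {V : Type*} [Fintype V] (c : ℕ) (G : SimpleGraph V) : Prop :=
  c < Fintype.card V ∧
    ∀ S : Finset V, S.card < c → (G.induce ((S : Set V)ᶜ)).Connected

/-- `G` is planar (Wagner's characterization): `G` has neither a `K₅`-minor nor a
`K₃,₃`-minor. -/
def IsPlanar {V : Type*} (G : SimpleGraph V) : Prop :=
  ¬ HasMinor G (⊤ : SimpleGraph (Fin 5)) ∧
  ¬ HasMinor G (completeBipartiteGraph (Fin 3) (Fin 3))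

/-- `c` is a proper edge coloring of `G`: edges sharing an endpoint get distinct colors. -/
def IsProperEdgeColoring {V : Type*} (G : SimpleGraph V) (c : Sym2 V → ℕ) : Prop :=
  ∀ ⦃u v w⦄, G.Adj u v → G.Adj u w → v ≠ w → c s(u, v) ≠ c s(u, w)

/-- The chromatic index `χ'(G)`: the least `k` such that `G` has a proper edge coloring
using colors `0, …, k-1`. -/
noncomputable def chromaticIndex {V : Type*} (G : SimpleGraph V) : ℕ :=
  sInf {k | ∃ c : Sym2 V → ℕ, IsProperEdgeColoring G c ∧ ∀ e ∈ G.edgeSet, c e < k}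

/-- `G` is `k`-edge-choosable: for every assignment of a list of `k` colors to each edge
there is a proper edge coloring choosing each edge's color from its list. -/
def EdgeChoosable {V : Type*} (G : SimpleGraph V) (k : ℕ) : Prop :=
  ∀ L : Sym2 V → Finset ℕ, (∀ e ∈ G.edgeSet, (L e).card = k) →
    ∃ c : Sym2 V → ℕ, IsProperEdgeColoring G c ∧ ∀ e ∈ G.edgeSet, c e ∈ L e

/-- The edge choosability `ch'(G)`: the least `k` such that `G` is `k`-edge-choosable. -/
noncomputable def edgeChoosability {V : Type*} (G : SimpleGraph V) : ℕ :=
  sInf {k | EdgeChoosable G k}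

/-- The subdivision of `H`: every edge `uv` is replaced by a path `u – w_{uv} – v` through
a new vertex `w_{uv}` corresponding to that edge. -/
def subdivision {V : Type*} (H : SimpleGraph V) : SimpleGraph (V ⊕ H.edgeSet) :=
  SimpleGraph.fromRel fun x y =>
    match x, y with
    | Sum.inl u, Sum.inr e => u ∈ (e : Sym2 V)
    | _, _ => False

/-- The square `G²` of `G`: two distinct vertices are adjacent iff their distance in `G`
is at most `2`, i.e. they are adjacent or have a common neighbour. -/
def squareGraph {V : Type*} (G : SimpleGraph V) : SimpleGraph V :=
  SimpleGraph.fromRel fun u v => G.Adj u v ∨ ∃ w, G.Adj u w ∧ G.Adj w v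
section Vizing

open Finset
open scoped Classical

theorem sum_deficiency_component_le_two {V : Type*} [Fintype V] (H : SimpleGraph V)
    (C : H.ConnectedComponent) (m : V → ℕ) (hm : ∀ x, m x + H.degree x ≤ 2) :
    ∑ x with H.connectedComponentMk x = C, m x ≤ 2 := by
  have h1 := C.connected_toSimpleGraph.card_vert_le_card_edgeSet_add_one
  have h2 := C.toSimpleGraph.sum_degrees_eq_twice_card_edges
  have h3 : ∀ x : C, C.toSimpleGraph.degree x ≤ H.degree x := fun x => by
    rw [← card_neighborFinset_eq_degree, ← card_neighborFinset_eq_degree]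
    refine card_le_card_of_injOn (fun y => (y : V)) ?_ Subtype.val_injective.injOn
    intro y hy
    have hxy : C.toSimpleGraph.Adj x y := (mem_neighborFinset ..).1 (mem_coe.1 hy)
    exact mem_coe.2 ((mem_neighborFinset ..).2 hxy)
  have h4 : ∑ x : C, (m x + C.toSimpleGraph.degree x) ≤ ∑ x : C, 2 :=
    sum_le_sum fun x _ => (Nat.add_le_add_left (h3 x) _).trans (hm x)
  rw [sum_add_distrib, h2] at h4
  rw [Nat.card_eq_fintype_card, Nat.card_eq_fintype_card, ← edgeFinset_card] at h1
  have h5 : ∑ x with H.connectedComponentMk x = C, m x = ∑ x : C, m x := by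
    refine sum_subtype _ (fun x => ?_) m
    simp only [mem_filter, mem_univ, true_and]
    exact Iff.rfl
  have h6 : ∑ x : C, 2 = Fintype.card C * 2 := by simp
  omega

theorem exists_kempe_swap {V : Type*} {G : SimpleGraph V} {c : Sym2 V → ℕ}
    (hc : IsProperEdgeColoring G c) (i j : ℕ) (K : Set V)
    (hK : ∀ x y, G.Adj x y → (c s(x, y) = i ∨ c s(x, y) = j) → (x ∈ K ↔ y ∈ K)) :
    ∃ c' : Sym2 V → ℕ, IsProperEdgeColoring G c' ∧ ∀ x y, G.Adj x y →
      c' s(x, y) = if x ∈ K then Equiv.swap i j (c s(x, y)) else c s(x, y) := by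
  have key : ∀ x y, G.Adj x y →
      (if ∃ z ∈ s(x, y), z ∈ K then Equiv.swap i j (c s(x, y)) else c s(x, y)) =
        if x ∈ K then Equiv.swap i j (c s(x, y)) else c s(x, y) := by
    intro x y hxy
    by_cases hx : x ∈ K
    · rw [if_pos ⟨x, by simp, hx⟩, if_pos hx]
    rw [if_neg hx]
    split_ifs with h
    · obtain ⟨z, hz, hzK⟩ := h
      obtain rfl | rfl := Sym2.mem_iff.1 hz
      · exact absurd hzK hx
      have := mt (hK x z hxy) (by tauto)
      push Not at this
      exact Equiv.swap_apply_of_ne_of_ne this.1 this.2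
    · rfl
  refine ⟨fun e => if ∃ z ∈ e, z ∈ K then Equiv.swap i j (c e) else c e, ?_, key⟩
  intro u v w huv huw hvw
  simp only
  rw [key u v huv, key u w huw]
  have := hc huv huw hvw
  split_ifs
  · exact fun h => this ((Equiv.swap i j).injective h)
  · exact this

theorem sum_lt_sum_of_pair {ι : Type*} {s : Finset ι} {i j : ι} (hi : i ∈ s)
    (hj : j ∈ s) (hij : i ≠ j) {f g : ι → ℕ} (h : ∀ l, l ≠ i → l ≠ j → f l = g l)
    (hlt : f i + f j < g i + g j) : ∑ l ∈ s, f l < ∑ l ∈ s, g l := by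
  have hj' : j ∈ s.erase i := mem_erase.2 ⟨hij.symm, hj⟩
  rw [← add_sum_erase s f hi, ← add_sum_erase s g hi, ← add_sum_erase _ f hj',
    ← add_sum_erase _ g hj']
  have : ∑ l ∈ (s.erase i).erase j, f l = ∑ l ∈ (s.erase i).erase j, g l :=
    sum_congr rfl fun l hl => by
      simp only [mem_erase] at hl
      exact h l hl.2.1 hl.1
  omega

/-- `c` properly colors the edges of `G` from `P`, and `M u` is a set of `n u` colors of `P`
that do not appear at `u`. -/
structure IsColoringWithMissing {V : Type*} (G : SimpleGraph V) (P : Finset ℕ) (n : V → ℕ)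
    (c : Sym2 V → ℕ) (M : V → Finset ℕ) : Prop where
  proper : IsProperEdgeColoring G c
  mem : ∀ ⦃x y⦄, G.Adj x y → c s(x, y) ∈ P
  subset : ∀ u, M u ⊆ P
  missing : ∀ ⦃u w⦄, G.Adj u w → c s(u, w) ∉ M u
  card : ∀ u, (M u).card = n u

theorem IsColoringWithMissing.exists_lt {V : Type*} [Fintype V] {G : SimpleGraph V}
    {P : Finset ℕ} {n : V → ℕ} {c : Sym2 V → ℕ} {M : V → Finset ℕ}
    (h : IsColoringWithMissing G P n c M) {i j : ℕ} (hi : i ∈ P) (hj : j ∈ P)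
    (hij : #{u | j ∈ M u} + 2 < #{u | i ∈ M u}) :
    ∃ c' M', IsColoringWithMissing G P n c' M' ∧
      ∑ l ∈ P, #{u | l ∈ M' u} ^ 2 < ∑ l ∈ P, #{u | l ∈ M u} ^ 2 := by
  have hne : i ≠ j := by rintro rfl; omega
  obtain ⟨H, hH⟩ : ∃ H : SimpleGraph V, ∀ x y,
      H.Adj x y ↔ G.Adj x y ∧ (c s(x, y) = i ∨ c s(x, y) = j) :=
    ⟨{  Adj := fun x y => G.Adj x y ∧ (c s(x, y) = i ∨ c s(x, y) = j)
        symm := ⟨fun x y hxy => by rwa [G.adj_comm, Sym2.eq_swap]⟩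
        loopless := ⟨fun x hx => G.loopless.1 x hx.1⟩ }, fun _ _ => Iff.rfl⟩
  have hdeg : ∀ x, ((if i ∈ M x then 1 else 0) + if j ∈ M x then 1 else 0) + H.degree x ≤ 2 := by
    intro x
    have h1 : H.degree x ≤ #(({i, j} : Finset ℕ) \ M x) := by
      rw [← card_neighborFinset_eq_degree]
      refine card_le_card_of_injOn (fun y => c s(x, y)) ?_ ?_
      · intro y hy
        have hy := (hH x y).1 (by simpa using hy)
        simpa using ⟨hy.2, h.missing hy.1⟩
      · intro y hy z hz hyz
        have hy := (hH x y).1 (by simpa using hy)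
        have hz := (hH x z).1 (by simpa using hz)
        by_contra hne
        exact h.proper hy.1 hz.1 hne hyz
    rw [sdiff_eq_filter, card_filter, sum_pair hne] at h1
    split_ifs at h1 ⊢ <;> omega
  have hcomp : ∀ l, #{u | l ∈ M u} = ∑ C : H.ConnectedComponent,
      #{u | l ∈ M u ∧ H.connectedComponentMk u = C} := by
    intro l
    rw [card_eq_sum_card_fiberwise (f := H.connectedComponentMk) (t := univ) (by simp)]
    simp [filter_filter]
  obtain ⟨C, hC⟩ : ∃ C : H.ConnectedComponent,
      #{u | j ∈ M u ∧ H.connectedComponentMk u = C} <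
        #{u | i ∈ M u ∧ H.connectedComponentMk u = C} := by
    by_contra! hcon
    have := sum_le_sum fun C (_ : C ∈ univ) => hcon C
    rw [← hcomp, ← hcomp] at this
    omega
  have htwo : #{u | i ∈ M u ∧ H.connectedComponentMk u = C} +
      #{u | j ∈ M u ∧ H.connectedComponentMk u = C} ≤ 2 := by
    have := sum_deficiency_component_le_two H C
      (fun x => (if i ∈ M x then 1 else 0) + if j ∈ M x then 1 else 0) hdeg
    rw [sum_add_distrib, ← card_filter, ← card_filter, filter_filter, filter_filter] at this
    simpa only [and_comm] using this
  obtain ⟨c', hc', hcc'⟩ := exists_kempe_swap h.proper i j {x | H.connectedComponentMk x = C}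
    (fun x y hxy hc => by
      have : H.connectedComponentMk x = H.connectedComponentMk y :=
        ConnectedComponent.sound ((hH x y).2 ⟨hxy, hc⟩).reachable
      simp [this])
  simp only [Set.mem_ofPred_eq] at hcc'
  have hswapP : ∀ l, Equiv.swap i j l ∈ P ↔ l ∈ P := by
    intro l
    rcases eq_or_ne l i with rfl | h1
    · simp [hi, hj]
    rcases eq_or_ne l j with rfl | h2
    · simp [hi, hj]
    rw [Equiv.swap_apply_of_ne_of_ne h1 h2]
  let M' : V → Finset ℕ := fun u =>
    if H.connectedComponentMk u = C then (M u).map (Equiv.swap i j).toEmbedding else M u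
  have hM' : ∀ l u, l ∈ M' u ↔
      (l ∈ M u ∧ ¬ H.connectedComponentMk u = C) ∨
        (Equiv.swap i j l ∈ M u ∧ H.connectedComponentMk u = C) := by
    intro l u
    by_cases hu : H.connectedComponentMk u = C
    · simp only [M', hu, if_true, mem_map_equiv, Equiv.symm_swap]
      tauto
    · simp [M', hu]
  have hcount : ∀ l, #{u | l ∈ M' u} = #{u | l ∈ M u ∧ ¬ H.connectedComponentMk u = C} +
      #{u | Equiv.swap i j l ∈ M u ∧ H.connectedComponentMk u = C} := by
    intro l
    simp only [hM']
    rw [filter_or, card_union_of_disjoint]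
    rw [disjoint_filter]
    tauto
  have hsplit : ∀ l, #{u | l ∈ M u} = #{u | l ∈ M u ∧ ¬ H.connectedComponentMk u = C} +
      #{u | l ∈ M u ∧ H.connectedComponentMk u = C} := by
    intro l
    rw [add_comm, ← filter_filter, ← filter_filter, card_filter_add_card_filter_not]
  refine ⟨c', M', ⟨hc', ?_, ?_, ?_, ?_⟩, ?_⟩
  · intro x y hxy
    rw [hcc' x y hxy]
    split_ifs
    · exact (hswapP _).2 (h.mem hxy)
    · exact h.mem hxy
  · intro u l hl
    rcases (hM' l u).1 hl with hl | hl
    · exact h.subset u hl.1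
    · exact (hswapP l).1 (h.subset u hl.1)
  · intro u w huw
    rw [hcc' u w huw, hM']
    by_cases hu : H.connectedComponentMk u = C
    · simpa [hu] using h.missing huw
    · simpa [hu] using h.missing huw
  · intro u
    rw [← h.card u]
    simp only [M']
    split_ifs <;> simp
  · refine sum_lt_sum_of_pair hi hj hne ?_ ?_
    · intro l hli hlj
      rw [hcount, hsplit, Equiv.swap_apply_of_ne_of_ne hli hlj]
    · have h1 := hcount i
      have h2 := hcount j
      have h3 := hsplit i
      have h4 := hsplit j
      rw [Equiv.swap_apply_left] at h1
      rw [Equiv.swap_apply_right] at h2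
      rw [h1, h2]
      rw [h3, h4] at hij
      rw [h3, h4]
      generalize #{u | i ∈ M u ∧ H.connectedComponentMk u = C} = a at *
      generalize #{u | j ∈ M u ∧ H.connectedComponentMk u = C} = b at *
      obtain ⟨rfl, rfl⟩ | ⟨rfl, rfl⟩ : (a = 1 ∧ b = 0) ∨ (a = 2 ∧ b = 0) := by omega
      all_goals nlinarith

theorem exists_isColoringWithMissing {V : Type*} [Fintype V] {G : SimpleGraph V} {P : Finset ℕ}
    {n : V → ℕ} {c : Sym2 V → ℕ} (hc : IsProperEdgeColoring G c)
    (hP : ∀ ⦃x y⦄, G.Adj x y → c s(x, y) ∈ P) (hn : ∀ u, n u = 0 ∨ n u + G.degree u ≤ #P) :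
    ∃ M, IsColoringWithMissing G P n c M := by
  have : ∀ u, ∃ M ⊆ P \ (G.neighborFinset u).image fun w => c s(u, w), #M = n u := by
    intro u
    refine exists_subset_card_eq ?_
    have h1 := le_card_sdiff ((G.neighborFinset u).image fun w => c s(u, w)) P
    have h2 : #((G.neighborFinset u).image fun w => c s(u, w)) ≤ G.degree u := card_image_le
    have := hn u
    omega
  choose M hM hcard using this
  refine ⟨M, hc, hP, fun u => (hM u).trans sdiff_subset, ?_, hcard⟩
  intro u w huw hmem
  have := (mem_sdiff.1 (hM u hmem)).2
  exact this (mem_image_of_mem _ (by simpa using huw))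

/-- If some total count of missing colors is odd and small, recoloring yields a color missing
at exactly one vertex. -/
theorem exists_color_missing_once {V : Type*} [Fintype V] {G : SimpleGraph V} {P : Finset ℕ}
    {n : V → ℕ} {c : Sym2 V → ℕ} {M : V → Finset ℕ} (h : IsColoringWithMissing G P n c M)
    (hodd : Odd (∑ u, n u)) (hlt : ∑ u, n u < 2 * #P) :
    ∃ c' M', IsColoringWithMissing G P n c' M' ∧ ∃ i ∈ P, #{u | i ∈ M' u} = 1 := by
  induction hm : ∑ l ∈ P, #{u | l ∈ M u} ^ 2 using Nat.strong_induction_on generalizing c M with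
  | _ m ih =>
  by_cases hbal : ∃ i ∈ P, ∃ j ∈ P, #{u | j ∈ M u} + 2 < #{u | i ∈ M u}
  · obtain ⟨i, hi, j, hj, hij⟩ := hbal
    obtain ⟨c', M', h', hlt'⟩ := h.exists_lt hi hj hij
    exact ih _ (hm ▸ hlt') h' rfl
  push Not at hbal
  have hsum : ∑ l ∈ P, #{u | l ∈ M u} = ∑ u, n u := by
    have := sum_card_bipartiteAbove_eq_sum_card_bipartiteBelow (s := P) (t := univ)
      (fun l u => l ∈ M u)
    simp only [bipartiteAbove, bipartiteBelow] at this
    rw [this]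
    refine sum_congr rfl fun u _ => ?_
    rw [← h.card u, filter_mem_eq_inter, inter_eq_right.2 (h.subset u)]
  by_contra! hcon
  have hne : ∀ i ∈ P, #{u | i ∈ M u} ≠ 1 := hcon c M h
  obtain ⟨i, hi, hi2⟩ : ∃ i ∈ P, #{u | i ∈ M u} < 2 := by
    by_contra! h2
    have := card_nsmul_le_sum P _ 2 h2
    rw [hsum, smul_eq_mul] at this
    omega
  have hi0 := hne i hi
  refine Nat.not_even_iff_odd.2 hodd (hsum ▸ even_sum _ fun j hj => ?_)
  have h1 := hbal j hj i hi
  have h2 := hne j hj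
  obtain h3 | h3 : #{u | j ∈ M u} = 0 ∨ #{u | j ∈ M u} = 2 := by omega
  all_goals rw [h3]; decide

theorem degree_deleteIncidenceSet_add_one_le {V : Type*} [Fintype V] {G : SimpleGraph V} {u v : V}
    (h : G.Adj u v) : (G.deleteIncidenceSet v).degree u + 1 ≤ G.degree u := by
  rw [← card_neighborFinset_eq_degree, ← card_neighborFinset_eq_degree, Nat.add_one_le_iff]
  refine card_lt_card ⟨fun x hx => ?_, fun hsub => ?_⟩
  · rw [mem_neighborFinset] at hx ⊢
    exact G.deleteIncidenceSet_le v hx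
  · have := hsub ((mem_neighborFinset ..).2 h)
    rw [mem_neighborFinset, deleteIncidenceSet_adj] at this
    exact this.2.2 rfl

/-- Extending a proper edge coloring of `G - v` to `G`, if `v` and its neighbors have
degree at most the number of colors, with equality for at most one neighbor. -/
theorem exists_proper_edge_coloring_of_deleteIncidenceSet {V : Type*} [Fintype V] (k : ℕ) :
    ∀ (G : SimpleGraph V) (v s : V) (P : Finset ℕ) (c : Sym2 V → ℕ), #P = k → G.degree v ≤ k →
      (∀ u, G.Adj v u → G.degree u ≤ k) → (∀ u, G.Adj v u → u ≠ s → G.degree u < k) →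
      IsProperEdgeColoring (G.deleteIncidenceSet v) c →
      (∀ ⦃x y⦄, (G.deleteIncidenceSet v).Adj x y → c s(x, y) ∈ P) →
      ∃ c', IsProperEdgeColoring G c' ∧ ∀ ⦃x y⦄, G.Adj x y → c' s(x, y) ∈ P := by
  induction k with
  | zero =>
    intro G v s P c _ hv _ _ hc hcP
    have h0 : ∀ u, ¬ G.Adj v u := fun u hu => by
      have := G.degree_pos_iff_exists_adj v |>.2 ⟨u, hu⟩
      omega
    have hadj : ∀ {x y}, G.Adj x y → (G.deleteIncidenceSet v).Adj x y := fun {x y} hxy =>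
      deleteIncidenceSet_adj.2 ⟨hxy, by rintro rfl; exact h0 _ hxy,
        by rintro rfl; exact h0 _ hxy.symm⟩
    exact ⟨c, fun x y z hxy hxz => hc (hadj hxy) (hadj hxz), fun x y hxy => hcP (hadj hxy)⟩
  | succ k ih =>
    intro G v s₀ P c hP hv hN hs₀ hc hcP
    by_cases h0 : ∀ u, ¬ G.Adj v u
    · have hadj : ∀ {x y}, G.Adj x y → (G.deleteIncidenceSet v).Adj x y := fun {x y} hxy =>
        deleteIncidenceSet_adj.2 ⟨hxy, by rintro rfl; exact h0 _ hxy,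
          by rintro rfl; exact h0 _ hxy.symm⟩
      exact ⟨c, fun x y z hxy hxz => hc (hadj hxy) (hadj hxz), fun x y hxy => hcP (hadj hxy)⟩
    push Not at h0
    obtain ⟨s, hvs, hs⟩ : ∃ s, G.Adj v s ∧ ∀ u, G.Adj v u → u ≠ s → G.degree u < k + 1 := by
      by_cases h : G.Adj v s₀
      · exact ⟨s₀, h, hs₀⟩
      · obtain ⟨s, hs⟩ := h0
        exact ⟨s, hs, fun u hu _ => hs₀ u hu (by rintro rfl; exact h hu)⟩
    clear hs₀ h0 s₀
    set n : V → ℕ := fun u => if G.Adj v u then (if u = s then 1 else 2) else 0 with hn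
    have hnP : ∀ u, n u = 0 ∨ n u + (G.deleteIncidenceSet v).degree u ≤ #P := by
      intro u
      by_cases hu : G.Adj v u
      swap
      · simp [hn, hu]
      right
      have h1 := degree_deleteIncidenceSet_add_one_le hu.symm
      have h2 := hN u hu
      simp only [hn, hu, if_true]
      split_ifs with hus
      · omega
      · have := hs u hu hus
        omega
    have hnsum : ∑ u, n u + 1 = 2 * G.degree v := by
      have h1 : ∑ u, n u + ∑ u, (if u = s then 1 else 0) = ∑ u, if G.Adj v u then 2 else 0 := by
        rw [← sum_add_distrib]
        refine sum_congr rfl fun u _ => ?_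
        simp only [hn]
        split_ifs with h1 h2 h2 <;> first | rfl | exact absurd (h2 ▸ hvs) h1
      rw [sum_ite_eq' univ s, if_pos (mem_univ s)] at h1
      rw [h1, ← sum_filter, sum_const, smul_eq_mul, mul_comm, ← card_neighborFinset_eq_degree,
        neighborFinset_eq_filter]
    obtain ⟨M₀, hM₀⟩ := exists_isColoringWithMissing hc hcP fun u => by
      convert hnP u
    obtain ⟨c, M, h, i, hi, hiM⟩ := exists_color_missing_once hM₀
      (by rw [Nat.odd_iff]; omega) (by omega)
    obtain ⟨u, hu⟩ := card_eq_one.1 hiM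
    have hiM : ∀ w, i ∈ M w ↔ w = u := fun w => by simpa using Finset.ext_iff.1 hu w
    have hvu : G.Adj v u := by
      by_contra hvu
      have h1 := h.card u
      simp only [hn, hvu, if_false, card_eq_zero] at h1
      have := (hiM u).2 rfl
      simp [h1] at this
    obtain ⟨G', hG'⟩ : ∃ G' : SimpleGraph V, ∀ x y, G'.Adj x y ↔
        G.Adj x y ∧ s(x, y) ≠ s(v, u) ∧ ¬ (x ≠ v ∧ y ≠ v ∧ c s(x, y) = i) :=
      ⟨{  Adj := fun x y => G.Adj x y ∧ s(x, y) ≠ s(v, u) ∧ ¬ (x ≠ v ∧ y ≠ v ∧ c s(x, y) = i)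
          symm := ⟨fun x y hxy => by
            rw [G.adj_comm, Sym2.eq_swap]
            exact ⟨hxy.1, hxy.2.1, fun h => hxy.2.2 ⟨h.2.1, h.1, h.2.2⟩⟩⟩
          loopless := ⟨fun x hx => G.loopless.1 x hx.1⟩ }, fun _ _ => Iff.rfl⟩
    have hG'v : ∀ {x y}, (G'.deleteIncidenceSet v).Adj x y →
        (G.deleteIncidenceSet v).Adj x y ∧ c s(x, y) ≠ i := by
      intro x y hxy
      rw [deleteIncidenceSet_adj, hG'] at hxy
      rw [deleteIncidenceSet_adj]
      exact ⟨⟨hxy.1.1, hxy.2⟩, fun hci => hxy.1.2.2 ⟨hxy.2.1, hxy.2.2, hci⟩⟩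
    have hdegv : G'.degree v ≤ k := by
      rw [← Nat.lt_add_one_iff]
      refine lt_of_lt_of_le ?_ hv
      rw [← card_neighborFinset_eq_degree, ← card_neighborFinset_eq_degree]
      refine card_lt_card ⟨fun x hx => ?_, fun hsub => ?_⟩
      · rw [mem_neighborFinset] at hx ⊢
        exact ((hG' _ _).1 hx).1
      · have := hsub ((mem_neighborFinset ..).2 hvu)
        rw [mem_neighborFinset, hG'] at this
        exact this.2.1 rfl
    have hdegw : ∀ w, G'.Adj v w → G'.degree w + #(M w) ≤ k + 1 := by
      intro w hw
      have hw' := (hG' _ _).1 hw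
      have hwu : w ≠ u := by rintro rfl; exact hw'.2.1 rfl
      have h1 : #((G'.neighborFinset w).erase v) ≤ #(P.erase i \ M w) := by
        refine card_le_card_of_injOn (fun y => c s(w, y)) ?_ ?_
        · intro y hy
          rw [mem_coe, mem_erase, mem_neighborFinset] at hy
          have := hG'v (deleteIncidenceSet_adj.2 ⟨hy.2, hw.ne', hy.1⟩)
          simp only [coe_sdiff, coe_erase, Set.mem_sdiff, mem_coe, Set.mem_singleton_iff]
          exact ⟨⟨h.mem this.1, this.2⟩, h.missing this.1⟩
        · intro y hy z hz hyz
          rw [mem_coe, mem_erase, mem_neighborFinset] at hy hz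
          by_contra hne
          exact h.proper (hG'v (deleteIncidenceSet_adj.2 ⟨hy.2, hw.ne', hy.1⟩)).1
            (hG'v (deleteIncidenceSet_adj.2 ⟨hz.2, hw.ne', hz.1⟩)).1 hne hyz
      have hsub : M w ⊆ P.erase i := fun l hl =>
        mem_erase.2 ⟨by rintro rfl; exact hwu ((hiM w).1 hl), h.subset w hl⟩
      rw [card_erase_of_mem ((mem_neighborFinset ..).2 hw.symm), card_sdiff_of_subset hsub,
        card_erase_of_mem hi, card_neighborFinset_eq_degree] at h1
      have := card_le_card hsub
      rw [card_erase_of_mem hi] at this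
      omega
    obtain ⟨c₁, hc₁, hc₁P⟩ := ih G' v s (P.erase i) c (by rw [card_erase_of_mem hi, hP]; rfl) hdegv
      (fun w hw => by
        have h1 := hdegw w hw
        have h2 := h.card w
        simp only [hn, ((hG' _ _).1 hw).1, if_true] at h2
        split_ifs at h2 <;> omega)
      (fun w hw hws => by
        have h1 := hdegw w hw
        have h2 := h.card w
        simp only [hn, ((hG' _ _).1 hw).1, if_true, hws, if_false] at h2
        omega)
      (fun x y z hxy hxz => h.proper (hG'v hxy).1 (hG'v hxz).1)
      (fun x y hxy => mem_erase.2 ⟨(hG'v hxy).2, h.mem (hG'v hxy).1⟩)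
    have hnot : ∀ x y, G.Adj x y → ¬ G'.Adj x y → s(x, y) = s(v, u) ∨
        ((G.deleteIncidenceSet v).Adj x y ∧ c s(x, y) = i) := by
      intro x y hxy hxy'
      rw [hG'] at hxy'
      rw [deleteIncidenceSet_adj]
      tauto
    have hmix : ∀ x y z, s(x, y) = s(v, u) → (G.deleteIncidenceSet v).Adj x z →
        c s(x, z) = i → False := by
      intro x y z hxy hxz hci
      have hx : x ≠ v := (deleteIncidenceSet_adj.1 hxz).2.1
      obtain rfl : x = u := by
        rcases Sym2.eq_iff.1 hxy with h | h
        · exact absurd h.1 hx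
        · exact h.1
      exact h.missing hxz (hci ▸ (hiM x).2 rfl)
    refine ⟨fun e => if e ∈ G'.edgeSet then c₁ e else i, ?_, ?_⟩
    · intro x y z hxy hxz hyz
      simp only [mem_edgeSet]
      split_ifs with h1 h2 h2
      · exact hc₁ h1 h2 hyz
      · exact (mem_erase.1 (hc₁P h1)).1
      · exact (mem_erase.1 (hc₁P h2)).1.symm
      · exfalso
        rcases hnot x y hxy h1 with h3 | h3 <;> rcases hnot x z hxz h2 with h4 | h4
        · exact hyz (Sym2.congr_right.1 (h3.trans h4.symm))
        · exact hmix x y z h3 h4.1 h4.2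
        · exact hmix x z y h4 h3.1 h3.2
        · exact h.proper h3.1 h4.1 hyz (h3.2.trans h4.2.symm)
    · intro x y hxy
      simp only [mem_edgeSet]
      split_ifs with h1
      · exact mem_of_mem_erase (hc₁P h1)
      · exact hi

/-- **Vizing's theorem**: a graph all of whose degrees are at most `d` has a proper edge
coloring with `d + 1` colors. -/
theorem exists_proper_edge_coloring_of_degree_le {V : Type*} [Fintype V] {d : ℕ}
    (G : SimpleGraph V) (hG : ∀ v, G.degree v ≤ d) :
    ∃ c, IsProperEdgeColoring G c ∧ ∀ ⦃x y⦄, G.Adj x y → c s(x, y) < d + 1 := by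
  suffices H : ∀ (A : Finset V) (G : SimpleGraph V), (∀ v, G.degree v ≤ d) →
      (∀ x y, G.Adj x y → x ∈ A) → ∃ c, IsProperEdgeColoring G c ∧
        ∀ ⦃x y⦄, G.Adj x y → c s(x, y) ∈ range (d + 1) by
    simpa using H univ G hG (by simp)
  intro A
  induction A using Finset.induction_on with
  | empty =>
    intro G _ hA
    exact ⟨fun _ => 0, fun x y _ hxy => absurd (hA x y hxy) (notMem_empty x),
      fun x y hxy => absurd (hA x y hxy) (notMem_empty x)⟩
  | insert v A _ ih =>
    intro G hG hA
    obtain ⟨c, hc, hcP⟩ := ih (G.deleteIncidenceSet v)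
      (fun w => by
        have : (G.deleteIncidenceSet v).degree w ≤ d :=
          (degree_le_of_le (G.deleteIncidenceSet_le v)).trans (hG w)
        convert this)
      (fun x y hxy => by
        rw [deleteIncidenceSet_adj] at hxy
        exact mem_of_mem_insert_of_ne (hA x y hxy.1) hxy.2.1)
    exact exists_proper_edge_coloring_of_deleteIncidenceSet (d + 1) G v v _ c (card_range _)
      (Nat.le_succ_of_le (hG v)) (fun u _ => Nat.le_succ_of_le (hG u))
      (fun u _ _ => Nat.lt_succ_of_le (hG u)) hc hcP

end Vizing

section CliqueMinors

/-- `b` can be reached from `a` by a walk of `T` inside `B`. -/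
def ReachableIn {W : Type*} (T : SimpleGraph W) (B : Set W) : W → W → Prop :=
  Relation.ReflTransGen fun a b => T.Adj a b ∧ a ∈ B ∧ b ∈ B

theorem ReachableIn.symm {W : Type*} {T : SimpleGraph W} {B : Set W} {a b : W}
    (h : ReachableIn T B a b) : ReachableIn T B b a := by
  induction h with
  | refl => exact Relation.ReflTransGen.refl
  | tail _ h ih => exact Relation.ReflTransGen.head ⟨h.1.symm, h.2.2, h.2.1⟩ ih

theorem ReachableIn.trans {W : Type*} {T : SimpleGraph W} {B : Set W} {a b c : W}
    (h : ReachableIn T B a b) (h' : ReachableIn T B b c) : ReachableIn T B a c :=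
  Relation.ReflTransGen.trans h h'

theorem ReachableIn.of_adj {W : Type*} {T : SimpleGraph W} {B : Set W} {a b : W}
    (h : T.Adj a b) (ha : a ∈ B) (hb : b ∈ B) : ReachableIn T B a b :=
  Relation.ReflTransGen.single ⟨h, ha, hb⟩

theorem ReachableIn.map {V W : Type*} {H : SimpleGraph V} {T : SimpleGraph W} {A : Set V}
    {B : Set W} (f : V → W)
    (hf : ∀ a b, H.Adj a b → a ∈ A → b ∈ A → T.Adj (f a) (f b) ∧ f a ∈ B ∧ f b ∈ B)
    {a b : V} (h : ReachableIn H A a b) : ReachableIn T B (f a) (f b) := by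
  induction h with
  | refl => exact Relation.ReflTransGen.refl
  | tail _ h ih => exact Relation.ReflTransGen.tail ih (hf _ _ h.1 h.2.1 h.2.2)

theorem ReachableIn.mem_of_ne {W : Type*} {T : SimpleGraph W} {B : Set W} {a b : W}
    (h : ReachableIn T B a b) (hab : a ≠ b) : b ∈ B := by
  rcases Relation.ReflTransGen.cases_tail h with h | ⟨c, -, hc⟩
  · exact absurd h.symm hab
  · exact hc.2.2

theorem connected_induce_of_reachableIn {W : Type*} {T : SimpleGraph W} {B : Set W} {a : W}
    (ha : a ∈ B) (h : ∀ b ∈ B, ReachableIn T B a b) : (T.induce B).Connected := by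
  have key : ∀ b, ReachableIn T B a b → ∀ hb : b ∈ B, (T.induce B).Reachable ⟨a, ha⟩ ⟨b, hb⟩ := by
    intro b hab
    induction hab with
    | refl => exact fun _ => Reachable.refl _
    | tail _ hbc ih =>
      exact fun _ => (ih hbc.2.1).trans (Adj.reachable hbc.1)
  exact (connected_iff _).2 ⟨fun x y => (key _ (h x x.2) x.2).symm.trans (key _ (h y y.2) y.2),
    ⟨⟨a, ha⟩⟩⟩

theorem hasCliqueMinor_of_fintype {W ι : Type*} [Fintype ι] {H : SimpleGraph W} {t : ℕ}
    (ht : t ≤ Fintype.card ι) (B : ι → Set W) (hdisj : Pairwise fun i j => Disjoint (B i) (B j))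
    (hconn : ∀ i, (H.induce (B i)).Connected)
    (hadj : Pairwise fun i j => ∃ u ∈ B i, ∃ v ∈ B j, H.Adj u v) : HasCliqueMinor H t := by
  obtain ⟨f⟩ : Nonempty (Fin t ↪ ι) := Function.Embedding.nonempty_of_card_le (by simpa using ht)
  refine ⟨fun i => B (f i), fun i => ?_, fun i j hij => hdisj (f.injective.ne hij),
    fun i => hconn _, fun i j hij => hadj (f.injective.ne hij)⟩
  obtain ⟨x⟩ := (hconn (f i)).nonempty
  exact ⟨x.1, x.2⟩

theorem HasCliqueMinor.mono {W : Type*} {H : SimpleGraph W} {s t : ℕ} (h : HasCliqueMinor H t)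
    (hst : s ≤ t) : HasCliqueMinor H s := by
  obtain ⟨B, -, hB⟩ := h
  exact hasCliqueMinor_of_fintype (by simpa using hst) B hB.1 hB.2.1 hB.2.2

theorem HasCliqueMinor.map {W W' : Type*} {H : SimpleGraph W} {H' : SimpleGraph W'} {t : ℕ}
    (h : HasCliqueMinor H t) (f : H →g H') (hf : Function.Injective f) : HasCliqueMinor H' t := by
  obtain ⟨B, -, hdisj, hconn, hadj⟩ := h
  refine hasCliqueMinor_of_fintype (by simp) (fun i => f '' B i)
    (fun i j hij => (Set.disjoint_image_iff hf).2 (hdisj hij)) (fun i => ?_) fun i j hij => ?_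
  · let g : H.induce (B i) →g H'.induce (f '' B i) :=
      { toFun := fun x => ⟨f x.1, Set.mem_image_of_mem f x.2⟩
        map_rel' := fun {a b} hab => f.map_adj hab }
    refine (hconn i).map g ?_
    rintro ⟨_, x, hx, rfl⟩
    exact ⟨⟨x, hx⟩, rfl⟩
  · obtain ⟨u, hu, v, hv, huv⟩ := hadj hij
    exact ⟨f u, Set.mem_image_of_mem f hu, f v, Set.mem_image_of_mem f hv, f.map_adj huv⟩

theorem HasCliqueMinor.le_card {W : Type*} [Finite W] {H : SimpleGraph W} {t : ℕ}
    (h : HasCliqueMinor H t) : t ≤ Nat.card W := by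
  obtain ⟨B, hne, hdisj, -⟩ := h
  choose f hf using hne
  have hinj : Function.Injective f := fun i j hij => by
    by_contra hne
    exact Set.disjoint_left.1 (hdisj hne) (hf i) (hij ▸ hf j)
  simpa using Nat.card_le_card_of_injective f hinj

/-- A clique together with disjoint, pairwise adjacent connected sets that dominate it. -/
theorem hasCliqueMinor_of_clique {W ι : Type*} [Fintype ι] {T : SimpleGraph W} {Q : Finset W}
    (hQ : T.IsClique Q) (B : ι → Set W) (hconn : ∀ i, (T.induce (B i)).Connected)
    (hdisj : Pairwise fun i j => Disjoint (B i) (B j)) (hQB : ∀ q ∈ Q, ∀ i, q ∉ B i)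
    (hdom : ∀ q ∈ Q, ∀ i, ∃ b ∈ B i, T.Adj q b)
    (hadj : Pairwise fun i j => ∃ u ∈ B i, ∃ v ∈ B j, T.Adj u v) :
    HasCliqueMinor T (Q.card + Fintype.card ι) := by
  refine hasCliqueMinor_of_fintype (ι := Q ⊕ ι) (by simp) (Sum.elim (fun q => {q.1}) B) ?_ ?_ ?_
  · rintro (q | i) (q' | j) h
    · rw [Sum.elim_inl, Sum.elim_inl, Set.disjoint_singleton]
      exact fun h' => h (congrArg Sum.inl (Subtype.ext h'))
    · simpa using hQB q q.2 j
    · simpa using hQB q' q'.2 i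
    · exact hdisj fun h' => h (congrArg Sum.inr h')
  · rintro (q | i)
    · exact connected_induce_of_reachableIn (Set.mem_singleton _)
        (by rintro _ rfl; exact Relation.ReflTransGen.refl)
    · exact hconn i
  · rintro (q | i) (q' | j) h
    · exact ⟨q, rfl, q', rfl, hQ q.2 q'.2 fun h' => h (congrArg Sum.inl (Subtype.ext h'))⟩
    · obtain ⟨b, hb, hqb⟩ := hdom q q.2 j
      exact ⟨q, rfl, b, hb, hqb⟩
    · obtain ⟨b, hb, hqb⟩ := hdom q' q'.2 i
      exact ⟨b, hb, q', rfl, hqb.symm⟩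
    · exact hadj fun h' => h (congrArg Sum.inr h')

end CliqueMinors

section TotalGraph

variable {V : Type*} {G : SimpleGraph V}

@[simp] theorem totalGraph_adj_inl_inl {x y : V} :
    (totalGraph G).Adj (Sum.inl x) (Sum.inl y) ↔ G.Adj x y := by
  simp only [totalGraph, fromRel_adj, ne_eq, Sum.inl.injEq]
  exact ⟨fun h => h.2.elim id Adj.symm, fun h => ⟨h.ne, Or.inl h⟩⟩

@[simp] theorem totalGraph_adj_inl_inr {x : V} {e : G.edgeSet} :
    (totalGraph G).Adj (Sum.inl x) (Sum.inr e) ↔ x ∈ (e : Sym2 V) := by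
  simp [totalGraph]

@[simp] theorem totalGraph_adj_inr_inl {x : V} {e : G.edgeSet} :
    (totalGraph G).Adj (Sum.inr e) (Sum.inl x) ↔ x ∈ (e : Sym2 V) := by
  simp [totalGraph]

@[simp] theorem totalGraph_adj_inr_inr {e f : G.edgeSet} :
    (totalGraph G).Adj (Sum.inr e) (Sum.inr f) ↔
      e ≠ f ∧ ∃ u, u ∈ (e : Sym2 V) ∧ u ∈ (f : Sym2 V) := by
  simp only [totalGraph, fromRel_adj, ne_eq, Sum.inr.injEq]
  refine and_congr_right fun _ => ⟨?_, Or.inl⟩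
  rintro (h | ⟨u, hu⟩)
  · exact h
  · exact ⟨u, hu.symm⟩

theorem HasCliqueMinor.totalGraph_mono {H : SimpleGraph V} {t : ℕ}
    (h : HasCliqueMinor (totalGraph H) t) (hHG : H ≤ G) : HasCliqueMinor (totalGraph G) t := by
  refine h.map ⟨Sum.map id (Set.inclusion (edgeSet_mono hHG)), ?_⟩ ?_
  · rintro (x | e) (y | f) hxy
    · simpa using hHG (by simpa using hxy)
    · simpa using hxy
    · simpa using hxy
    · simpa [Subtype.ext_iff] using hxy
  · exact Sum.map_injective.2 ⟨Function.injective_id, Set.inclusion_injective _⟩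

/-- `G` has a total coloring with colors `0, …, k - 1`. -/
def IsTotallyColorable (G : SimpleGraph V) (k : ℕ) : Prop :=
  ∃ cv ce, IsTotalColoring G cv ce ∧ (∀ v, cv v < k) ∧ ∀ e, ce e < k

theorem IsTotallyColorable.mono {k l : ℕ} (h : IsTotallyColorable G k) (hkl : k ≤ l) :
    IsTotallyColorable G l := by
  obtain ⟨cv, ce, h, hv, he⟩ := h
  exact ⟨cv, ce, h, fun v => (hv v).trans_le hkl, fun e => (he e).trans_le hkl⟩

/-- The coloring of the elements of `V ⊕ E` given by a coloring of vertices and pairs. -/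
def elementColoring (G : SimpleGraph V) (cv : V → ℕ) (ce : Sym2 V → ℕ) : V ⊕ G.edgeSet → ℕ :=
  Sum.elim cv fun e => ce e

theorem IsTotalColoring.edge_ne {cv : V → ℕ} {ce : Sym2 V → ℕ} (h : IsTotalColoring G cv ce)
    {e f : Sym2 V} (he : e ∈ G.edgeSet) (hf : f ∈ G.edgeSet) (hef : e ≠ f) {u : V} (hue : u ∈ e)
    (huf : u ∈ f) : ce e ≠ ce f := by
  obtain ⟨v, rfl⟩ := Sym2.mem_iff_exists.1 hue
  obtain ⟨w, rfl⟩ := Sym2.mem_iff_exists.1 huf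
  exact h.2.1 he hf (by rintro rfl; exact hef rfl)

theorem IsTotalColoring.edge_ne_vertex {cv : V → ℕ} {ce : Sym2 V → ℕ}
    (h : IsTotalColoring G cv ce) {e : Sym2 V} (he : e ∈ G.edgeSet) {u : V} (hue : u ∈ e) :
    ce e ≠ cv u := by
  obtain ⟨v, rfl⟩ := Sym2.mem_iff_exists.1 hue
  exact (h.2.2 he).1

theorem IsTotallyColorable.colorable {k : ℕ} (h : IsTotallyColorable G k) :
    (totalGraph G).Colorable k := by
  obtain ⟨cv, ce, h, hv, he⟩ := h
  refine ⟨Coloring.mk (Sum.elim (fun v => ⟨cv v, hv v⟩) fun e => ⟨ce e, he e⟩) ?_⟩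
  rintro (x | e) (y | f) hxy
  · simpa using h.1 (by simpa using hxy)
  · simpa using (h.edge_ne_vertex f.2 (by simpa using hxy)).symm
  · simpa using h.edge_ne_vertex e.2 (by simpa using hxy)
  · rw [totalGraph_adj_inr_inr] at hxy
    obtain ⟨hne, u, hue, huf⟩ := hxy
    simpa using h.edge_ne e.2 f.2 (Subtype.coe_injective.ne hne) hue huf

theorem isTotallyColorable_of_proper {k : ℕ} (c : V ⊕ G.edgeSet → ℕ) (hk : 0 < k)
    (hck : ∀ x, c x < k) (hc : ∀ x y, (totalGraph G).Adj x y → c x ≠ c y) :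
    IsTotallyColorable G k := by
  classical
  refine ⟨fun v => c (Sum.inl v), fun e => if h : e ∈ G.edgeSet then c (Sum.inr ⟨e, h⟩) else 0,
    ⟨fun u v huv => hc _ _ (by simpa using huv), fun u v w huv huw hvw => ?_,
      fun u v huv => ?_⟩, fun v => hck _, fun e => ?_⟩
  · simp only [mem_edgeSet, huv, huw, dif_pos]
    refine hc _ _ (totalGraph_adj_inr_inr.2 ⟨fun h => hvw ?_, u, by simp, by simp⟩)
    exact Sym2.congr_right.1 (Subtype.ext_iff.1 h)
  · simp only [mem_edgeSet, huv, dif_pos]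
    exact ⟨hc _ _ (totalGraph_adj_inr_inl.2 (by simp)), hc _ _ (totalGraph_adj_inr_inl.2 (by simp))⟩
  · simp only
    split_ifs
    · exact hck _
    · exact hk

end TotalGraph

section Greedy

open Finset
open scoped Classical

/-- `c` uses colors less than `k`, and is proper outside of `R`. -/
def IsProperOff {W : Type*} (T : SimpleGraph W) (k : ℕ) (R : Finset W) (c : W → ℕ) : Prop :=
  (∀ x, c x < k) ∧ ∀ x y, T.Adj x y → x ∉ R → y ∉ R → c x ≠ c y

theorem IsProperOff.exists_extend {W : Type*} [Fintype W] {T : SimpleGraph W} {k : ℕ}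
    {R : Finset W} {c : W → ℕ} (h : IsProperOff T k R c) {w : W}
    (hw : #((T.neighborFinset w \ R).image c) < k) :
    ∃ c', IsProperOff T k (R.erase w) c' ∧ ∀ x, x ≠ w → c' x = c x := by
  obtain ⟨a, ha, ha'⟩ := exists_mem_notMem_of_card_lt_card (hw.trans_eq (card_range k).symm)
  rw [mem_range] at ha
  have key : ∀ x, T.Adj w x → x ∉ R → a ≠ c x := by
    rintro x hx hxR rfl
    exact ha' (mem_image_of_mem _ (mem_sdiff.2 ⟨(mem_neighborFinset ..).2 hx, hxR⟩))
  refine ⟨Function.update c w a, ⟨fun x => ?_, fun x y hxy hx hy => ?_⟩,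
    fun x hx => Function.update_of_ne hx _ _⟩
  · rcases eq_or_ne x w with rfl | hx
    · simpa using ha
    · simpa [hx] using h.1 x
  · rw [mem_erase, not_and] at hx hy
    rcases eq_or_ne x w with rfl | hxw
    · simpa [hxy.ne'] using key y hxy (hy hxy.ne')
    rcases eq_or_ne y w with rfl | hyw
    · simpa [hxw] using (key x hxy.symm (hx hxw)).symm
    · simpa [hxw, hyw] using h.2 x y hxy (hx hxw) (hy hyw)

theorem IsProperOff.exists_extend_of_degree_lt {W : Type*} [Fintype W] {T : SimpleGraph W} {k : ℕ}
    {R : Finset W} {c : W → ℕ} (h : IsProperOff T k R c) {w : W} (hw : T.degree w < k) :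
    ∃ c', IsProperOff T k (R.erase w) c' ∧ ∀ x, x ≠ w → c' x = c x := by
  refine h.exists_extend ((card_image_le.trans (card_le_card sdiff_subset)).trans_lt ?_)
  rwa [card_neighborFinset_eq_degree]

theorem IsProperOff.exists_extend_of_degree_le {W : Type*} [Fintype W] {T : SimpleGraph W} {k : ℕ}
    {R : Finset W} {c : W → ℕ} (h : IsProperOff T k R c) {w y : W} (hw : T.degree w ≤ k)
    (hwy : T.Adj w y) (hy : y ∈ R) :
    ∃ c', IsProperOff T k (R.erase w) c' ∧ ∀ x, x ≠ w → c' x = c x := by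
  refine h.exists_extend (card_image_le.trans_lt (lt_of_lt_of_le ?_ hw))
  rw [← card_neighborFinset_eq_degree]
  refine card_lt_card ⟨sdiff_subset, fun hsub => ?_⟩
  exact (mem_sdiff.1 (hsub ((mem_neighborFinset ..).2 hwy))).2 hy

/-- Greedy completion of a partial coloring towards a root `r` two of whose neighbors
already have the same color. -/
theorem IsProperOff.exists_proper {W : Type*} [Fintype W] {T : SimpleGraph W} {k : ℕ}
    {c : W → ℕ} {r p q : W} (f : W → ℕ) (hp : T.Adj r p) (hq : T.Adj r q) (hpq : p ≠ q) :
    ∀ {R : Finset W}, IsProperOff T k R c → r ∈ R → p ∉ R → q ∉ R → c p = c q →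
      (∀ x ∈ R, T.degree x ≤ k) → (∀ x ∈ R, x ≠ r → ∃ y ∈ R, T.Adj x y ∧ f y < f x) →
      ∃ c', IsProperOff T k ∅ c' := by
  intro R
  induction hn : #R generalizing R c with
  | zero => intro _ hr; simp [card_eq_zero.1 hn] at hr
  | succ n ih =>
    intro h hr hpR hqR hcpq hdeg hf
    by_cases hR : (R.erase r).Nonempty
    · obtain ⟨w, hw, hmax⟩ := exists_max_image (R.erase r) f hR
      obtain ⟨hwr, hwR⟩ := mem_erase.1 hw
      obtain ⟨y, hyR, hwy, -⟩ := hf w hwR hwr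
      obtain ⟨c', hc', hcc'⟩ := h.exists_extend_of_degree_le (hdeg w hwR) hwy hyR
      refine ih (by rw [card_erase_of_mem hwR, hn]; rfl) hc' (mem_erase.2 ⟨hwr.symm, hr⟩)
        (fun h => hpR (mem_of_mem_erase h)) (fun h => hqR (mem_of_mem_erase h)) ?_
        (fun x hx => hdeg x (mem_of_mem_erase hx)) ?_
      · rwa [hcc' p (by rintro rfl; exact hpR hwR), hcc' q (by rintro rfl; exact hqR hwR)]
      · intro x hx hxr
        obtain ⟨hxw, hxR⟩ := mem_erase.1 hx
        obtain ⟨y, hy, hxy, hlt⟩ := hf x hxR hxr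
        refine ⟨y, mem_erase.2 ⟨?_, hy⟩, hxy, hlt⟩
        rintro rfl
        exact hlt.not_ge (hmax x (mem_erase.2 ⟨hxr, hxR⟩))
    · rw [not_nonempty_iff_eq_empty] at hR
      obtain ⟨c', hc', -⟩ := h.exists_extend (w := r) <| by
        have h1 : (T.neighborFinset r \ R).image c ⊆ ((T.neighborFinset r).erase p).image c := by
          intro a ha
          obtain ⟨x, hx, rfl⟩ := mem_image.1 ha
          rcases eq_or_ne x p with rfl | hxp
          · rw [hcpq]
            exact mem_image_of_mem _ (mem_erase.2 ⟨hpq.symm, (mem_neighborFinset ..).2 hq⟩)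
          · exact mem_image_of_mem _ (mem_erase.2 ⟨hxp, (mem_sdiff.1 hx).1⟩)
        refine ((card_le_card h1).trans card_image_le).trans_lt (lt_of_lt_of_le ?_ (hdeg r hr))
        rw [← card_neighborFinset_eq_degree]
        exact card_erase_lt_of_mem ((mem_neighborFinset ..).2 hp)
      exact ⟨c', hR ▸ hc'⟩

theorem degree_totalGraph_inl_le {V : Type*} [Fintype V] (G : SimpleGraph V) (x : V) :
    (totalGraph G).degree (Sum.inl x) ≤ 2 * G.degree x := by
  have h : (totalGraph G).neighborFinset (Sum.inl x) ⊆ (G.neighborFinset x).image Sum.inl ∪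
      (G.neighborFinset x).attach.image fun y : {y // y ∈ G.neighborFinset x} =>
        (Sum.inr ⟨s(x, y.1), (mem_neighborFinset ..).1 y.2⟩ : V ⊕ G.edgeSet) := by
    rintro (y | ⟨e, he⟩) hy <;> rw [mem_neighborFinset] at hy
    · simpa using hy
    · obtain ⟨y, rfl⟩ := Sym2.mem_iff_exists.1 (totalGraph_adj_inl_inr.1 hy)
      refine mem_union_right _ (mem_image.2 ⟨⟨y, (mem_neighborFinset ..).2 he⟩, mem_attach _ _, rfl⟩)
  have := (card_le_card h).trans (card_union_le _ _)
  rw [card_neighborFinset_eq_degree] at this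
  have h1 := card_image_le (s := G.neighborFinset x) (f := (Sum.inl : V → V ⊕ G.edgeSet))
  have h2 := card_image_le (s := (G.neighborFinset x).attach)
    (f := fun y => (Sum.inr ⟨s(x, y.1), (mem_neighborFinset ..).1 y.2⟩ : V ⊕ G.edgeSet))
  rw [card_attach] at h2
  rw [card_neighborFinset_eq_degree] at h1 h2
  omega

theorem degree_totalGraph_inr_le {V : Type*} [Fintype V] {G : SimpleGraph V} {x y : V}
    (hxy : G.Adj x y) :
    (totalGraph G).degree (Sum.inr ⟨s(x, y), G.mem_edgeSet.2 hxy⟩) ≤ G.degree x + G.degree y := by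
  have key : ∀ x y, G.Adj x y →
      #(insert (Sum.inl x : V ⊕ Sym2 V)
        (((G.neighborFinset x).erase y).image fun z => (Sum.inr s(x, z) : V ⊕ Sym2 V))) ≤
        G.degree x := by
    intro x y hxy
    refine (card_insert_le _ _).trans ?_
    have := card_image_le (s := (G.neighborFinset x).erase y)
      (f := fun z => (Sum.inr s(x, z) : V ⊕ Sym2 V))
    have h2 := card_erase_add_one ((mem_neighborFinset ..).2 hxy : y ∈ G.neighborFinset x)
    rw [card_neighborFinset_eq_degree] at h2
    omega
  rw [← card_neighborFinset_eq_degree]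
  refine (card_le_card_of_injOn (Sum.map id Subtype.val) (t := _ ∪ _) ?_
    (Sum.map_injective.2 ⟨Function.injective_id, Subtype.val_injective⟩).injOn).trans
    ((card_union_le _ _).trans (Nat.add_le_add (key x y hxy) (key y x hxy.symm)))
  rintro (z | ⟨e, he⟩) hz <;> rw [mem_coe, mem_neighborFinset] at hz
  · simpa [or_comm] using hz
  · rw [totalGraph_adj_inr_inr] at hz
    obtain ⟨hne, u, hu, hue⟩ := hz
    obtain ⟨z, rfl⟩ := Sym2.mem_iff_exists.1 hue
    replace hne : s(x, y) ≠ s(u, z) := fun h => hne (Subtype.ext h)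
    have hz : G.Adj u z := he
    rcases Sym2.mem_iff.1 hu with rfl | rfl
    · have : z ≠ y := by rintro rfl; exact hne rfl
      simp only [coe_union, Set.mem_union, mem_coe]
      left
      simp only [Sum.map_inr, mem_insert, reduceCtorEq, false_or]
      exact mem_image_of_mem _ (mem_erase.2 ⟨this, (mem_neighborFinset ..).2 hz⟩)
    · have : z ≠ x := by rintro rfl; exact hne Sym2.eq_swap
      simp only [coe_union, Set.mem_union, mem_coe]
      right
      simp only [Sum.map_inr, mem_insert, reduceCtorEq, false_or]
      exact mem_image_of_mem _ (mem_erase.2 ⟨this, (mem_neighborFinset ..).2 hz⟩)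

end Greedy

section Hadwiger

open Finset
open scoped Classical

variable {V : Type*}

theorem hasCliqueMinor_of_star [Fintype V] {H : SimpleGraph V} {v : V} {ι : Type*} [Fintype ι]
    (B : ι → Set (V ⊕ H.edgeSet)) (hconn : ∀ i, ((totalGraph H).induce (B i)).Connected)
    (hdisj : Pairwise fun i j => Disjoint (B i) (B j)) (hv : ∀ i, Sum.inl v ∉ B i)
    (he : ∀ i, ∀ e : H.edgeSet, v ∈ (e : Sym2 V) → Sum.inr e ∉ B i)
    (hdomv : ∀ i, ∃ b ∈ B i, (totalGraph H).Adj (Sum.inl v) b)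
    (hdome : ∀ i, ∀ e : H.edgeSet, v ∈ (e : Sym2 V) →
      ∃ b ∈ B i, (totalGraph H).Adj (Sum.inr e) b)
    (hadj : Pairwise fun i j => ∃ a ∈ B i, ∃ b ∈ B j, (totalGraph H).Adj a b) :
    HasCliqueMinor (totalGraph H) (H.degree v + 1 + Fintype.card ι) := by
  let f : {y // y ∈ H.neighborFinset v} → V ⊕ H.edgeSet :=
    fun y => Sum.inr ⟨s(v, y.1), (mem_neighborFinset ..).1 y.2⟩
  have hf : Function.Injective f := fun y z h =>
    Subtype.ext (Sym2.congr_right.1 (Subtype.ext_iff.1 (Sum.inr_injective h)))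
  have hQ : ∀ q ∈ insert (Sum.inl v) (univ.image f),
      q = Sum.inl v ∨ ∃ e : H.edgeSet, v ∈ (e : Sym2 V) ∧ q = Sum.inr e := by
    intro q hq
    rcases mem_insert.1 hq with rfl | hq
    · exact Or.inl rfl
    · obtain ⟨y, -, rfl⟩ := mem_image.1 hq
      exact Or.inr ⟨_, Sym2.mem_mk_left _ _, rfl⟩
  have hcard : #(insert (Sum.inl v) (univ.image f)) = H.degree v + 1 := by
    rw [card_insert_of_notMem (by simp [f]), card_image_of_injective _ hf, card_univ,
      Fintype.card_coe, card_neighborFinset_eq_degree]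
  rw [← hcard]
  refine hasCliqueMinor_of_clique ?_ B hconn hdisj ?_ ?_ hadj
  · intro q hq q' hq' hne
    rcases hQ q hq with rfl | ⟨e, he, rfl⟩ <;> rcases hQ q' hq' with rfl | ⟨e', he', rfl⟩
    · exact absurd rfl hne
    · exact totalGraph_adj_inl_inr.2 he'
    · exact totalGraph_adj_inr_inl.2 he
    · exact totalGraph_adj_inr_inr.2 ⟨fun h => hne (congrArg _ h), v, he, he'⟩
  · intro q hq i
    rcases hQ q hq with rfl | ⟨e, hve, rfl⟩
    · exact hv i
    · exact he i e hve
  · intro q hq i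
    rcases hQ q hq with rfl | ⟨e, hve, rfl⟩
    · exact hdomv i
    · exact hdome i e hve

theorem exists_perm_separating {k a b : ℕ} {S : Finset ℕ} (hak : a < k) (hbk : b < k)
    (haS : a ∉ S) (T : Finset ℕ) (hTk : ∀ x ∈ T, x < k)
    (hST : #S + #T + 1 ≤ k) :
    ∃ π : Equiv.Perm ℕ, (∀ n < k, π n < k) ∧ π b = a ∧ ∀ x ∈ T, π x ∉ S := by
  have hswap : ∀ {x y n : ℕ}, x < k → y < k → n < k → Equiv.swap x y n < k := by
    intro x y n hx hy hn
    rw [Equiv.swap_apply_def]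
    split_ifs <;> assumption
  induction T using Finset.induction_on with
  | empty => exact ⟨Equiv.swap b a, fun n hn => hswap hbk hak hn, by simp, by simp⟩
  | insert t T ht ih =>
    rw [card_insert_of_notMem ht] at hST
    obtain ⟨π, hπ, hba, hT⟩ := ih (fun x hx => hTk x (mem_insert_of_mem hx)) (by omega)
    by_cases hn : π t ∈ S
    · obtain ⟨c, hc, hc'⟩ := exists_mem_notMem_of_card_lt_card
        (s := insert a (S ∪ T.image π)) (t := range k) <| by
          rw [card_range]
          have h1 := card_insert_le a (S ∪ T.image π)
          have h2 := card_union_le S (T.image π)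
          have h3 := card_image_le (s := T) (f := π)
          omega
      simp only [mem_insert, mem_union, mem_image, not_or, not_exists, not_and] at hc'
      refine ⟨π.trans (Equiv.swap (π t) c), fun n hn' => hswap
        (hπ t (hTk t (mem_insert_self ..))) (mem_range.1 hc) (hπ n hn'), ?_, ?_⟩
      · rw [Equiv.trans_apply, hba, Equiv.swap_apply_of_ne_of_ne (by rintro rfl; exact haS hn)
          (Ne.symm hc'.1)]
      · intro x hx
        rcases mem_insert.1 hx with rfl | hx
        · simpa using hc'.2.1
        · rw [Equiv.trans_apply, Equiv.swap_apply_of_ne_of_ne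
            (fun h => hT x hx (by rwa [h])) (hc'.2.2 x hx)]
          exact hT x hx
    · refine ⟨π, hπ, hba, fun x hx => ?_⟩
      rcases mem_insert.1 hx with rfl | hx
      exacts [hn, hT x hx]

/-- Total colorings can be combined along a cut vertex `v`, which separates `A` from the
rest of the graph. -/
theorem IsTotallyColorable.of_cut [Fintype V] {H H₁ H₂ : SimpleGraph V} {v : V} {A : Set V} {k : ℕ}
    (hvA : v ∉ A) (hA : ∀ a b, H.Adj a b → a ∈ A → b ≠ v → b ∈ A)
    (hH₁ : ∀ a b, H.Adj a b → (a ∈ A ∨ b ∈ A) → H₁.Adj a b)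
    (hH₂ : ∀ a b, H.Adj a b → a ∉ A → b ∉ A → H₂.Adj a b)
    (h₁ : IsTotallyColorable H₁ k) (h₂ : IsTotallyColorable H₂ k) (hk : H.degree v + 1 ≤ k) :
    IsTotallyColorable H k := by
  obtain ⟨cv, ce, h₁, hcv, hce⟩ := h₁
  obtain ⟨cv', ce', h₂, hcv', hce'⟩ := h₂
  obtain ⟨π, hπ, hπv, hπe⟩ := exists_perm_separating (hcv v) (hcv' v)
    (S := ((H.neighborFinset v).filter (· ∈ A)).image fun y => ce s(v, y))
    (by
      intro h
      obtain ⟨y, hy, hyv⟩ := mem_image.1 h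
      obtain ⟨hy, hyA⟩ := mem_filter.1 hy
      exact (h₁.2.2 (hH₁ _ _ ((mem_neighborFinset ..).1 hy) (Or.inr hyA))).1 hyv)
    (((H.neighborFinset v).filter (· ∉ A)).image fun y => ce' s(v, y))
    (by
      intro x hx
      obtain ⟨y, -, rfl⟩ := mem_image.1 hx
      exact hce' _)
    (by
      have h1 := card_image_le (s := (H.neighborFinset v).filter (· ∈ A))
        (f := fun y => ce s(v, y))
      have h2 := card_image_le (s := (H.neighborFinset v).filter (· ∉ A))
        (f := fun y => ce' s(v, y))
      have h3 := card_filter_add_card_filter_not (s := H.neighborFinset v) (· ∈ A)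
      rw [card_neighborFinset_eq_degree] at h3
      omega)
  have hv₁ : ∀ a b, H.Adj a b → (a ∈ A ∨ b ∈ A) → (if a ∈ A then cv a else π (cv' a)) = cv a := by
    intro a b hab h
    split_ifs with ha
    · rfl
    · have : a = v := by
        by_contra hne
        exact ha (hA b a hab.symm (h.resolve_left ha) hne)
      rw [this, hπv]
  have hmix : ∀ u w w', H.Adj u w → H.Adj u w' → (u ∈ A ∨ w ∈ A) → ¬(u ∈ A ∨ w' ∈ A) →
      ce s(u, w) ≠ π (ce' s(u, w')) := by
    intro u w w' huw huw' h h' heq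
    rw [not_or] at h'
    obtain rfl : u = v := by
      by_contra hne
      exact h'.1 (hA w u huw.symm (h.resolve_left h'.1) hne)
    refine hπe (ce' s(u, w')) (mem_image_of_mem _ (mem_filter.2 ⟨?_, h'.2⟩)) ?_
    · exact (mem_neighborFinset ..).2 huw'
    · rw [← heq]
      exact mem_image_of_mem (fun y => ce s(u, y))
        (mem_filter.2 ⟨(mem_neighborFinset ..).2 huw, h.resolve_left h'.1⟩)
  have hmem : ∀ a b, (∃ x ∈ s(a, b), x ∈ A) ↔ (a ∈ A ∨ b ∈ A) := by simp
  refine ⟨fun x => if x ∈ A then cv x else π (cv' x),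
    fun e => if ∃ x ∈ e, x ∈ A then ce e else π (ce' e), ⟨?_, ?_, ?_⟩, ?_, ?_⟩
  · intro a b hab
    by_cases h : a ∈ A ∨ b ∈ A
    · simp only [hv₁ a b hab h, hv₁ b a hab.symm h.symm]
      exact h₁.1 (hH₁ a b hab h)
    · rw [not_or] at h
      simp only [h.1, h.2, if_false]
      exact π.injective.ne (h₂.1 (hH₂ a b hab h.1 h.2))
  · intro u w w' huw huw' hww'
    simp only [hmem]
    split_ifs with h h' h'
    · exact h₁.2.1 (hH₁ _ _ huw h) (hH₁ _ _ huw' h') hww'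
    · exact hmix u w w' huw huw' h h'
    · exact (hmix u w' w huw' huw h' h).symm
    · rw [not_or] at h h'
      exact π.injective.ne (h₂.2.1 (hH₂ _ _ huw h.1 h.2) (hH₂ _ _ huw' h'.1 h'.2) hww')
  · intro a b hab
    by_cases h : a ∈ A ∨ b ∈ A
    · simp only [hmem, hv₁ a b hab h, hv₁ b a hab.symm h.symm, h, if_true]
      exact h₁.2.2 (hH₁ a b hab h)
    · have h' := not_or.1 h
      simp only [hmem, h'.1, h'.2, if_false]
      have := h₂.2.2 (hH₂ a b hab h'.1 h'.2)
      exact ⟨π.injective.ne this.1, π.injective.ne this.2⟩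
  · intro x
    simp only
    split_ifs
    exacts [hcv _, hπ _ (hcv' _)]
  · intro e
    simp only
    split_ifs
    exacts [hce _, hπ _ (hce' _)]

theorem edgeChoosable_edgeChoosability [Fintype V] (H : SimpleGraph V) :
    EdgeChoosable H (edgeChoosability H) := by
  refine Nat.sInf_mem (s := {k | EdgeChoosable H k}) ⟨Fintype.card H.edgeSet, fun L hL => ?_⟩
  obtain ⟨f, hf, hfL⟩ := (all_card_le_biUnion_card_iff_exists_injective
    fun e : H.edgeSet => L e).1 <| by
      intro s
      rcases s.eq_empty_or_nonempty with rfl | ⟨e, he⟩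
      · simp
      · exact (card_le_univ s).trans ((hL e e.2).ge.trans (card_le_card
          (subset_biUnion_of_mem (fun e : H.edgeSet => L e) he)))
  refine ⟨fun e => if h : e ∈ H.edgeSet then f ⟨e, h⟩ else 0, fun u v w huv huw hvw => ?_,
    fun e he => ?_⟩
  · simp only [mem_edgeSet, huv, huw, dif_pos]
    exact hf.ne fun h => hvw (Sym2.congr_right.1 (Subtype.ext_iff.1 h))
  · simp only [he, dif_pos]
    exact hfL ⟨e, he⟩

theorem chromaticIndex_le [Fintype V] {H : SimpleGraph V} {d : ℕ} (hd : ∀ v, H.degree v ≤ d) :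
    chromaticIndex H ≤ d + 1 := by
  obtain ⟨c, hc, hlt⟩ := exists_proper_edge_coloring_of_degree_le (d := d) H
    (by convert hd)
  refine Nat.sInf_le ⟨c, hc, fun e he => ?_⟩
  induction e with
  | h x y => exact hlt he

theorem IsProperOff.exists_proper_of_degree_lt [Fintype V] {H : SimpleGraph V} {k : ℕ}
    (hk : ∀ v, H.degree v < k) :
    ∀ {R : Finset V} {c : V → ℕ}, IsProperOff H k R c → ∃ c', IsProperOff H k ∅ c' := by
  intro R
  induction R using Finset.strongInduction with
  | H R ih =>
    intro c hc
    rcases R.eq_empty_or_nonempty with rfl | ⟨w, hw⟩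
    · exact ⟨c, hc⟩
    · obtain ⟨c', hc', -⟩ := hc.exists_extend_of_degree_lt (hk w)
      exact ih _ (erase_ssubset hw) hc'

theorem isTotallyColorable_of_edgeChoosability [Fintype V] {H : SimpleGraph V} {d : ℕ}
    (hd : ∀ v, H.degree v ≤ d) (h : edgeChoosability H = chromaticIndex H) :
    IsTotallyColorable H (d + 3) := by
  obtain ⟨cv, hcv, hcv'⟩ := IsProperOff.exists_proper_of_degree_lt (H := H) (k := d + 3)
    (R := univ) (c := 0) (fun v => (hd v).trans_lt (by omega)) ⟨by simp, by simp⟩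
  have hlist : ∀ e : Sym2 V, ∃ L ⊆ range (d + 3) \ e.toFinset.image cv,
      #L = edgeChoosability H := by
    refine fun e => exists_subset_card_eq ?_
    have h1 := le_card_sdiff (e.toFinset.image cv) (range (d + 3))
    have h2 := card_image_le (s := e.toFinset) (f := cv)
    have h3 : #e.toFinset ≤ 2 := by
      rw [Sym2.card_toFinset]
      split_ifs <;> omega
    have h4 := chromaticIndex_le hd
    rw [card_range] at h1
    omega
  choose L hL hLcard using hlist
  obtain ⟨ce, hce, hceL⟩ := edgeChoosable_edgeChoosability H L fun e _ => hLcard e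
  have hmem : ∀ {x y}, H.Adj x y → ce s(x, y) ≠ cv x := by
    intro x y hxy heq
    refine (mem_sdiff.1 (hL _ (hceL s(x, y) hxy))).2 ?_
    rw [heq]
    exact mem_image_of_mem _ (by simp)
  refine ⟨cv, fun e => if e ∈ H.edgeSet then ce e else 0, ⟨?_, ?_, ?_⟩, hcv, ?_⟩
  · exact fun u v huv => hcv' u v huv (notMem_empty _) (notMem_empty _)
  · intro u v w huv huw hvw
    simp only [mem_edgeSet, huv, huw, if_true]
    exact hce huv huw hvw
  · intro u v huv
    simp only [mem_edgeSet, huv, if_true]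
    exact ⟨hmem huv, by rw [Sym2.eq_swap]; exact hmem huv.symm⟩
  · intro e
    simp only
    split_ifs with he
    · exact mem_range.1 (mem_sdiff.1 (hL _ (hceL _ he))).1
    · omega

theorem hasCliqueMinor_degree_add_one [Fintype V] (H : SimpleGraph V) (v : V) :
    HasCliqueMinor (totalGraph H) (H.degree v + 1) :=
  hasCliqueMinor_of_star (v := v) (ι := Empty) (fun i => i.elim) (fun i => i.elim)
    (fun i => i.elim) (fun i => i.elim) (fun i => i.elim) (fun i => i.elim) (fun i => i.elim)
    fun i => i.elim

theorem ReachableIn.totalGraph {H : SimpleGraph V} {A : Set V} {B : Set (V ⊕ H.edgeSet)}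
    {x y : V} (h : ReachableIn H A x y) (hB : ∀ x ∈ H.support, x ∈ A → Sum.inl x ∈ B) :
    ReachableIn (totalGraph H) B (Sum.inl x) (Sum.inl y) :=
  h.map Sum.inl fun a b hab ha hb => ⟨totalGraph_adj_inl_inl.2 hab,
    hB a ⟨b, hab⟩ ha, hB b ⟨a, hab.symm⟩ hb⟩

theorem hasCliqueMinor_degree_add_two [Fintype V] {H : SimpleGraph V} {v r : V}
    (hr : H.Adj v r) (hreach : ∀ x ∈ H.support, x ≠ v → ReachableIn H {v}ᶜ r x) :
    HasCliqueMinor (totalGraph H) (H.degree v + 2) := by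
  have hB : ∀ y, H.Adj v y → Sum.inl y ∈ Sum.inl '' {x | x ∈ H.support ∧ x ≠ v} :=
    fun y hy => Set.mem_image_of_mem (Sum.inl : V → V ⊕ H.edgeSet) ⟨⟨v, hy.symm⟩, hy.ne'⟩
  refine hasCliqueMinor_of_star (v := v) (ι := Unit)
    (fun _ => Sum.inl '' {x | x ∈ H.support ∧ x ≠ v}) (fun _ => ?_) (fun i j h => absurd rfl h)
    (by simp) (by simp) (fun _ => ⟨Sum.inl r, hB r hr, totalGraph_adj_inl_inl.2 hr⟩)
    (fun _ e he => ?_) fun i j h => absurd rfl h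
  · refine connected_induce_of_reachableIn (a := Sum.inl r) (hB r hr) ?_
    rintro _ ⟨x, hx, rfl⟩
    exact (hreach x hx.1 hx.2).totalGraph fun x hx hxv => Set.mem_image_of_mem _ ⟨hx, hxv⟩
  · obtain ⟨e, he'⟩ := e
    obtain ⟨y, rfl⟩ := Sym2.mem_iff_exists.1 he
    exact ⟨Sum.inl y, hB y he', totalGraph_adj_inr_inl.2 (Sym2.mem_mk_right _ _)⟩

theorem reachableIn_edges {H : SimpleGraph V} {A : Set V} {B : Set (V ⊕ H.edgeSet)} {w : V}
    {e : H.edgeSet} (hwe : w ∈ (e : Sym2 V)) (he : Sum.inr e ∈ B)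
    (hB : ∀ f : H.edgeSet, (∀ x ∈ (f : Sym2 V), x ∈ A) → Sum.inr f ∈ B) {x : V}
    (hwx : ReachableIn H A w x) {f : H.edgeSet} (hxf : x ∈ (f : Sym2 V))
    (hf : ∀ x ∈ (f : Sym2 V), x ∈ A) :
    ReachableIn (totalGraph H) B (Sum.inr e) (Sum.inr f) := by
  have hadj : ∀ {e f : H.edgeSet} {x : V}, x ∈ (e : Sym2 V) → x ∈ (f : Sym2 V) → Sum.inr e ∈ B →
      Sum.inr f ∈ B → ReachableIn (totalGraph H) B (Sum.inr e) (Sum.inr f) := by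
    intro e f x he hf heB hfB
    by_cases hef : e = f
    · rw [hef]
      exact Relation.ReflTransGen.refl
    · exact ReachableIn.of_adj (totalGraph_adj_inr_inr.2 ⟨hef, x, he, hf⟩) heB hfB
  induction hwx generalizing f with
  | refl => exact hadj hwe hxf he (hB f hf)
  | @tail a b _ hab ih =>
    have h : ∀ x ∈ s(a, b), x ∈ A := by
      intro x hx
      rcases Sym2.mem_iff.1 hx with rfl | rfl
      exacts [hab.2.1, hab.2.2]
    exact (ih (f := ⟨s(a, b), hab.1⟩) (Sym2.mem_mk_left _ _) h).trans
      (hadj (Sym2.mem_mk_right _ _) hxf (hB _ h) (hB f hf))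

theorem hasCliqueMinor_degree_add_three [Fintype V] {H : SimpleGraph V} {v r u w w' : V}
    (hr : H.Adj v r) (hu : H.Adj v u) (hru : r ≠ u) (hw : H.Adj u w) (hw' : H.Adj u w')
    (hww' : w ≠ w') (hwv : w ≠ v) (hwv' : w' ≠ v)
    (hreach : ∀ x ∈ H.support, x ≠ v → x ≠ u → ReachableIn H {v, u}ᶜ r x)
    (hdeg : ∀ x, H.Adj v x → x ≠ u → ∃ z, H.Adj x z ∧ z ≠ v ∧ z ≠ u) :
    HasCliqueMinor (totalGraph H) (H.degree v + 3) := by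
  let B₁ : Set (V ⊕ H.edgeSet) := {b | b = Sum.inl u ∨ b = Sum.inr ⟨s(u, w'), hw'⟩ ∨
    ∃ e : H.edgeSet, b = Sum.inr e ∧ v ∉ (e : Sym2 V) ∧ u ∉ (e : Sym2 V)}
  let B₂ : Set (V ⊕ H.edgeSet) := {b | b = Sum.inr ⟨s(u, w), hw⟩ ∨
    ∃ x, b = Sum.inl x ∧ x ∈ H.support ∧ x ≠ v ∧ x ≠ u}
  have h₁u : Sum.inl u ∈ B₁ := Or.inl rfl
  have h₁w : Sum.inr ⟨s(u, w'), hw'⟩ ∈ B₁ := Or.inr (Or.inl rfl)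
  have h₂w : Sum.inr ⟨s(u, w), hw⟩ ∈ B₂ := Or.inl rfl
  have h₂ : ∀ x ∈ H.support, x ≠ v → x ≠ u → Sum.inl x ∈ B₂ :=
    fun x hx hxv hxu => Or.inr ⟨x, rfl, hx, hxv, hxu⟩
  have hadj : (totalGraph H).Adj (Sum.inr ⟨s(u, w'), hw'⟩) (Sum.inr ⟨s(u, w), hw⟩) := by
    refine totalGraph_adj_inr_inr.2 ⟨fun h => hww' ?_, u, by simp, by simp⟩
    exact (Sym2.congr_right.1 (Subtype.ext_iff.1 h)).symm
  have hvw : v ∉ s(u, w) := by simp [hu.ne, hwv.symm]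
  have hvw' : v ∉ s(u, w') := by simp [hu.ne, hwv'.symm]
  refine hasCliqueMinor_of_star (v := v) (ι := Bool) (fun i => cond i B₁ B₂) ?_ ?_ ?_ ?_ ?_ ?_ ?_
  · rintro (_ | _)
    · refine connected_induce_of_reachableIn (h₂ w ⟨u, hw.symm⟩ hwv hw.ne') ?_
      rintro _ (rfl | ⟨x, rfl, hx, hxv, hxu⟩)
      · exact ReachableIn.of_adj (totalGraph_adj_inl_inr.2 (by simp))
          (h₂ w ⟨u, hw.symm⟩ hwv hw.ne') h₂w
      · refine ((hreach w ⟨u, hw.symm⟩ hwv hw.ne').symm.trans (hreach x hx hxv hxu)).totalGraph ?_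
        exact fun y hy hy' => h₂ y hy (fun h => hy' (Or.inl h)) fun h => hy' (Or.inr h)
    · refine connected_induce_of_reachableIn h₁w ?_
      rintro _ (rfl | rfl | ⟨⟨e, he⟩, rfl, hve, hue⟩)
      · exact ReachableIn.of_adj (totalGraph_adj_inr_inl.2 (by simp)) h₁w h₁u
      · exact Relation.ReflTransGen.refl
      · induction e with
        | h x y =>
          have hxv : x ≠ v := by rintro rfl; simp at hve
          have hxu : x ≠ u := by rintro rfl; simp at hue
          refine reachableIn_edges (A := {v, u}ᶜ) (w := w') (by simp) h₁w ?_
            ((hreach w' ⟨u, hw'.symm⟩ hwv' hw'.ne').symm.trans (hreach x ⟨y, he⟩ hxv hxu))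
            (by simp) ?_
          · exact fun f hf => Or.inr (Or.inr ⟨f, rfl, fun h => hf v h (by simp),
              fun h => hf u h (by simp)⟩)
          · rintro z hz (rfl | rfl)
            exacts [hve hz, hue hz]
  · have hdisj : Disjoint B₁ B₂ := by
      rw [Set.disjoint_left]
      rintro _ (rfl | rfl | ⟨e, rfl, hve, hue⟩) (h | ⟨x, h, hx, hxv, hxu⟩)
      · simp at h
      · exact hxu (Sum.inl_injective h).symm
      · exact hadj.ne h
      · simp at h
      · rw [Sum.inr.injEq] at h
        rw [h] at hue
        simp at hue
      · simp at h
    rintro (_ | _) (_ | _) h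
    exacts [absurd rfl h, hdisj.symm, hdisj, absurd rfl h]
  · rintro (_ | _)
    · rintro (h | ⟨x, h, hx, hxv, hxu⟩)
      · simp at h
      · exact hxv (Sum.inl_injective h).symm
    · rintro (h | h | ⟨x, h, -⟩)
      · exact hu.ne (Sum.inl_injective h)
      · simp at h
      · simp at h
  · rintro (_ | _) e he
    · rintro (h | ⟨x, h, -⟩)
      · rw [Sum.inr.injEq] at h
        rw [h] at he
        exact hvw he
      · simp at h
    · rintro (h | h | ⟨f, h, hvf, -⟩)
      · simp at h
      · rw [Sum.inr.injEq] at h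
        rw [h] at he
        exact hvw' he
      · rw [Sum.inr.injEq] at h
        rw [h] at he
        exact hvf he
  · rintro (_ | _)
    · exact ⟨_, h₂ r ⟨v, hr.symm⟩ hr.ne' hru, totalGraph_adj_inl_inl.2 hr⟩
    · exact ⟨_, h₁u, totalGraph_adj_inl_inl.2 hu⟩
  · intro i e he
    obtain ⟨e, he'⟩ := e
    obtain ⟨y, rfl⟩ := Sym2.mem_iff_exists.1 he
    have hy : H.Adj v y := he'
    by_cases hyu : y = u
    · subst hyu
      rcases i with _ | _
      · refine ⟨_, h₂w, totalGraph_adj_inr_inr.2 ⟨fun h => hvw ?_, y, by simp, by simp⟩⟩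
        have h' : s(v, y) = s(y, w) := Subtype.ext_iff.1 h
        rw [← h']
        simp
      · exact ⟨_, h₁u, totalGraph_adj_inr_inl.2 (by simp)⟩
    · rcases i with _ | _
      · exact ⟨_, h₂ y ⟨v, hy.symm⟩ hy.ne' hyu, totalGraph_adj_inr_inl.2 (by simp)⟩
      · obtain ⟨z, hyz, hzv, hzu⟩ := hdeg y hy hyu
        have hv : v ∉ s(y, z) := by simp [hy.ne, hzv.symm]
        refine ⟨Sum.inr ⟨s(y, z), hyz⟩, Or.inr (Or.inr ⟨_, rfl, hv, ?_⟩),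
          totalGraph_adj_inr_inr.2 ⟨fun h => hv ?_, y, by simp, by simp⟩⟩
        · simp [Ne.symm hyu, hzu.symm]
        · have h' : s(v, y) = s(y, z) := Subtype.ext_iff.1 h
          rw [← h']
          simp
  · rintro (_ | _) (_ | _) h
    · exact absurd rfl h
    · exact ⟨_, h₂w, _, h₁w, hadj.symm⟩
    · exact ⟨_, h₁w, _, h₂w, hadj⟩
    · exact absurd rfl h

theorem ReachableIn.exists_adj {H : SimpleGraph V} {a b x : V} (h : ReachableIn H {a}ᶜ x b)
    (hxb : x ≠ b) : ∃ u, H.Adj u b ∧ u ≠ a ∧ ReachableIn H {a, b}ᶜ x u := by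
  have key : ∀ z, ReachableIn H {a}ᶜ x z →
      (∃ u, H.Adj u b ∧ u ≠ a ∧ ReachableIn H {a, b}ᶜ x u) ∨
        (z ≠ b ∧ ReachableIn H {a, b}ᶜ x z) := by
    intro z hz
    induction hz with
    | refl => exact Or.inr ⟨hxb, Relation.ReflTransGen.refl⟩
    | @tail z z' _ h ih =>
      rcases ih with ih | ⟨hzb, hz⟩
      · exact Or.inl ih
      · by_cases hz' : z' = b
        · exact Or.inl ⟨z, hz' ▸ h.1, h.2.1, hz⟩
        · refine Or.inr ⟨hz', hz.trans (ReachableIn.of_adj h.1 ?_ ?_)⟩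
          · rintro (h' | h')
            exacts [h.2.1 h', hzb h']
          · rintro (h' | h')
            exacts [h.2.2 h', hz' h']
  exact (key b h).resolve_right fun h => h.1 rfl

/-- No vertex of `H` separates two other non-isolated vertices. -/
def HasNoCutVertex (H : SimpleGraph V) : Prop :=
  ∀ v, ∀ x ∈ H.support, ∀ y ∈ H.support, x ≠ v → y ≠ v → ReachableIn H {v}ᶜ x y

theorem HasNoCutVertex.exists_neighbor [Fintype V] {H : SimpleGraph V} (h : HasNoCutVertex H)
    {v r : V} (hr : H.Adj v r) (hne : ∃ u, H.Adj v u ∧ u ≠ r) :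
    ∃ u, H.Adj v u ∧ r ≠ u ∧ ∀ x ∈ H.support, x ≠ v → x ≠ u → ReachableIn H {v, u}ᶜ r x := by
  obtain ⟨u₀, hu₀, hu₀r⟩ := hne
  obtain ⟨u, hu, hmax⟩ := exists_max_image ((H.neighborFinset v).erase r)
    (fun u => #(univ.filter fun x => ReachableIn H {v, u}ᶜ r x))
    ⟨u₀, mem_erase.2 ⟨hu₀r, (mem_neighborFinset ..).2 hu₀⟩⟩
  obtain ⟨hur, hu⟩ := mem_erase.1 hu
  rw [mem_neighborFinset] at hu
  refine ⟨u, hu, hur.symm, fun x hx hxv hxu => ?_⟩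
  by_contra hrx
  obtain ⟨u', hu', hu'u, hxu'⟩ :=
    (h u x hx v ⟨u, hu⟩ hxu hu.ne).exists_adj hxv
  rw [Set.pair_comm] at hxu'
  have hru' : ¬ ReachableIn H {v, u}ᶜ r u' := fun h => hrx (h.trans hxu'.symm)
  have hu'r : u' ≠ r := by
    rintro rfl
    exact hru' Relation.ReflTransGen.refl
  have hsub : ∀ y, ReachableIn H {v, u}ᶜ r y → ReachableIn H {v, u'}ᶜ r y := by
    intro y hy
    induction hy with
    | refl => exact Relation.ReflTransGen.refl
    | @tail y y' hy hyy' ih =>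
      refine ih.trans (ReachableIn.of_adj hyy'.1 ?_ ?_)
      · rintro (h' | h')
        · exact hyy'.2.1 (Or.inl h')
        · rw [Set.mem_singleton_iff] at h'
          exact hru' (h' ▸ hy)
      · rintro (h' | h')
        · exact hyy'.2.2 (Or.inl h')
        · rw [Set.mem_singleton_iff] at h'
          exact hru' (h' ▸ hy.tail hyy')
  refine (hmax u' (mem_erase.2 ⟨hu'r, (mem_neighborFinset ..).2 hu'.symm⟩)).not_gt
    (card_lt_card ((ssubset_iff_of_subset ?_).2 ⟨u, ?_, ?_⟩))
  · intro y hy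
    simp only [mem_filter, mem_univ, true_and] at hy ⊢
    exact hsub y hy
  · simp only [mem_filter, mem_univ, true_and]
    obtain ⟨z, hzu, hzv, hrz⟩ :=
      (h v r ⟨v, hr.symm⟩ u ⟨v, hu.symm⟩ hr.ne' hu.ne').exists_adj hur.symm
    refine (hsub z hrz).trans (ReachableIn.of_adj hzu ?_ ?_)
    · rintro (h' | h')
      · exact hzv h'
      · rw [Set.mem_singleton_iff] at h'
        exact hru' (h' ▸ hrz)
    · rintro (h' | h')
      exacts [hu.ne' h', hu'u.symm h']
  · simp only [mem_filter, mem_univ, true_and]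
    exact fun h => h.mem_of_ne hur.symm (Or.inr rfl)

theorem exists_rank {W : Type*} (T : SimpleGraph W) (B : Set W) (r : W) :
    ∃ f : W → ℕ, ∀ x, ReachableIn T B r x → x ≠ r → ∃ y ∈ B, T.Adj x y ∧ f y < f x := by
  let T' : SimpleGraph W :=
    { Adj := fun a b => T.Adj a b ∧ a ∈ B ∧ b ∈ B
      symm := ⟨fun _ _ h => ⟨h.1.symm, h.2.2, h.2.1⟩⟩
      loopless := ⟨fun _ h => h.1.ne rfl⟩ }
  refine ⟨fun x => T'.dist x r, fun x hx hxr => ?_⟩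
  have : T'.Reachable x r := by
    clear hxr
    induction hx with
    | refl => exact Reachable.refl _
    | tail _ h ih => exact (Adj.reachable (G := T') h).symm.trans ih
  obtain ⟨p, hp⟩ := this.exists_walk_length_eq_dist
  cases p with
  | nil => exact absurd rfl hxr
  | @cons _ y _ h p =>
    refine ⟨y, h.2.2, h.1, ?_⟩
    have := dist_le p
    rw [Walk.length_cons] at hp
    exact (Nat.lt_succ_of_le this).trans_eq hp

theorem isTotallyColorable_four [Fintype V] {H : SimpleGraph V} (hd : ∀ x, H.degree x ≤ 2)
    (h : HasNoCutVertex H) {v a b : V} (hva : H.Adj v a) (hvb : H.Adj v b) (hab : a ≠ b) :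
    IsTotallyColorable H 4 := by
  let R : Finset (V ⊕ H.edgeSet) := univ.filter
    (Sum.elim (fun x => x ∈ H.support ∧ x ≠ b) fun e => (e : Sym2 V) ≠ s(v, a))
  have hRv : ∀ x, Sum.inl x ∈ R ↔ x ∈ H.support ∧ x ≠ b := by simp [R]
  have hRe : ∀ e : H.edgeSet, Sum.inr e ∈ R ↔ (e : Sym2 V) ≠ s(v, a) := by
    intro e
    simp only [R, mem_filter, mem_univ, true_and, Sum.elim_inr]
  have hbva : b ∉ s(v, a) := by simp [hvb.ne', hab.symm]
  have hreach : ∀ x ∈ H.support, x ≠ b →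
      ReachableIn (totalGraph H) (R : Set (V ⊕ H.edgeSet)) (Sum.inl v) (Sum.inl x) :=
    fun x hx hxb => (h b v ⟨b, hvb⟩ x hx hvb.ne hxb).totalGraph fun y hy hyb => (hRv y).2 ⟨hy, hyb⟩
  obtain ⟨f, hf⟩ := exists_rank (totalGraph H) (R : Set (V ⊕ H.edgeSet)) (Sum.inl v)
  suffices ∃ c, IsProperOff (totalGraph H) 4 ∅ c by
    obtain ⟨c, hc, hc'⟩ := this
    exact isTotallyColorable_of_proper c (by omega) hc
      fun x y hxy => hc' x y hxy (notMem_empty _) (notMem_empty _)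
  refine IsProperOff.exists_proper (c := fun _ => 0) (r := Sum.inl v)
    (p := Sum.inr ⟨s(v, a), hva⟩) (q := Sum.inl b) (R := R) f
    (totalGraph_adj_inl_inr.2 (by simp)) (totalGraph_adj_inl_inl.2 hvb) (by simp)
    ⟨by simp, ?_⟩ ((hRv v).2 ⟨⟨b, hvb⟩, hvb.ne⟩) (by simp [hRe]) (by simp [hRv]) rfl ?_ ?_
  · have hV : ∀ x ∈ H.support, Sum.inl x ∉ R → x = b := by
      intro x hx hxR
      by_contra hxb
      exact hxR ((hRv x).2 ⟨hx, hxb⟩)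
    have hve : ∀ (x : V) (e : H.edgeSet), x ∈ (e : Sym2 V) → Sum.inl x ∉ R → Sum.inr e ∉ R →
        False := by
      intro x e hx hxR heR
      rw [hRe, not_not] at heR
      rw [heR] at hx
      refine hbva (hV x ?_ hxR ▸ hx)
      rcases Sym2.mem_iff.1 hx with rfl | rfl
      exacts [⟨a, hva⟩, ⟨v, hva.symm⟩]
    rintro (x | e) (y | f) hxy hx hy
    · rw [totalGraph_adj_inl_inl] at hxy
      exact absurd ((hV x ⟨y, hxy⟩ hx).trans (hV y ⟨x, hxy.symm⟩ hy).symm) hxy.ne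
    · exact (hve x f (totalGraph_adj_inl_inr.1 hxy) hx hy).elim
    · exact (hve y e (totalGraph_adj_inr_inl.1 hxy) hy hx).elim
    · rw [hRe, not_not] at hx hy
      exact absurd (Subtype.ext (hx.trans hy.symm)) (totalGraph_adj_inr_inr.1 hxy).1
  · rintro (x | ⟨e, he⟩) -
    · have := degree_totalGraph_inl_le H x
      have := hd x
      omega
    · induction e with
      | h x y =>
        exact (degree_totalGraph_inr_le he).trans (Nat.add_le_add (hd x) (hd y))
  · rintro (x | ⟨e, he⟩) hx hxv
    · obtain ⟨hx, hxb⟩ := (hRv x).1 hx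
      exact hf _ (hreach x hx hxb) hxv
    · refine hf _ ?_ hxv
      have key : ∃ x ∈ e, x ≠ b := by
        induction e with
        | h x y =>
          by_cases hxb : x = b
          · exact ⟨y, by simp, hxb ▸ (H.ne_of_adj he).symm⟩
          · exact ⟨x, by simp, hxb⟩
      obtain ⟨x, hxe, hxb⟩ := key
      obtain ⟨y, rfl⟩ := Sym2.mem_iff_exists.1 hxe
      exact (hreach x ⟨y, he⟩ hxb).tail ⟨totalGraph_adj_inl_inr.2 hxe, (hRv x).2 ⟨⟨y, he⟩, hxb⟩, hx⟩

theorem IsTotallyColorable.of_deleteEdges [Fintype V] {H : SimpleGraph V} {v u : V} {k : ℕ}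
    (hvu : H.Adj v u) (h : IsTotallyColorable (H.deleteEdges {s(v, u)}) k)
    (hu : 2 * H.degree u < k) (hdeg : H.degree v + H.degree u ≤ k) : IsTotallyColorable H k := by
  obtain ⟨cv, ce, h, hcv, hce⟩ := h
  have hc : IsProperOff (totalGraph H) k {Sum.inr ⟨s(v, u), hvu⟩, Sum.inl u}
      (elementColoring H cv ce) := by
    refine ⟨?_, ?_⟩
    · rintro (x | e)
      exacts [hcv x, hce e]
    have hedge : ∀ e : H.edgeSet,
        Sum.inr e ∉ ({Sum.inr ⟨s(v, u), hvu⟩, Sum.inl u} : Finset (V ⊕ H.edgeSet)) →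
        (e : Sym2 V) ∈ (H.deleteEdges {s(v, u)}).edgeSet := by
      intro e he
      rw [edgeSet_deleteEdges]
      refine ⟨e.2, fun h => he ?_⟩
      rw [Set.mem_singleton_iff] at h
      simp [← h]
    rintro (x | e) (y | f) hxy hx hy
    · rw [totalGraph_adj_inl_inl] at hxy
      refine h.1 ((deleteEdges_adj ..).2 ⟨hxy, fun h' => ?_⟩)
      have : u ∈ s(x, y) := by
        rw [Set.mem_singleton_iff.1 h']
        simp
      rcases Sym2.mem_iff.1 this with rfl | rfl
      exacts [hx (by simp), hy (by simp)]
    · exact (h.edge_ne_vertex (hedge f hy) (totalGraph_adj_inl_inr.1 hxy)).symm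
    · exact h.edge_ne_vertex (hedge e hx) (totalGraph_adj_inr_inl.1 hxy)
    · rw [totalGraph_adj_inr_inr] at hxy
      obtain ⟨hne, u, hue, huf⟩ := hxy
      exact h.edge_ne (hedge e hx) (hedge f hy) (Subtype.coe_injective.ne hne) hue huf
  obtain ⟨c₁, hc₁, -⟩ := hc.exists_extend_of_degree_le (w := Sum.inr ⟨s(v, u), hvu⟩)
    (y := Sum.inl u) ((degree_totalGraph_inr_le hvu).trans hdeg)
    (totalGraph_adj_inr_inl.2 (by simp)) (by simp)
  obtain ⟨c₂, hc₂, -⟩ := hc₁.exists_extend_of_degree_lt (w := Sum.inl u)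
    ((degree_totalGraph_inl_le H u).trans_lt hu)
  refine isTotallyColorable_of_proper c₂ (by omega) hc₂.1 fun x y hxy => hc₂.2 x y hxy ?_ ?_ <;>
  · simp
    tauto

theorem isTotallyColorable_of_not_hasCliqueMinor [Fintype V] [Nonempty V] (H : SimpleGraph V)
    (hH : ∀ H' ≤ H, edgeChoosability H' = chromaticIndex H') {t : ℕ}
    (ht : ¬ HasCliqueMinor (totalGraph H) (t + 1)) : IsTotallyColorable H t := by
  induction H using WellFoundedLT.induction with
  | ind H ih =>
  replace ih : ∀ H' < H, IsTotallyColorable H' t := fun H' hlt =>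
    ih H' hlt (fun H'' hle => hH H'' (hle.trans hlt.le)) fun h => ht (h.totalGraph_mono hlt.le)
  replace ht : ∀ {n}, HasCliqueMinor (totalGraph H) n → n ≤ t := by
    intro n hn
    by_contra hlt
    exact ht (hn.mono (by omega))
  obtain ⟨v, -, hd⟩ := exists_max_image univ (fun v => H.degree v) univ_nonempty
  replace hd : ∀ x, H.degree x ≤ H.degree v := fun x => hd x (mem_univ x)
  have ht₁ := ht (hasCliqueMinor_degree_add_one H v)
  by_cases hv : H.degree v = 0
  · have hnadj : ∀ x y, ¬ H.Adj x y := by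
      intro x y hxy
      have := (H.degree_pos_iff_exists_adj x).2 ⟨y, hxy⟩
      have := hd x
      omega
    exact ⟨fun _ => 0, fun _ => 0, ⟨fun x y h => (hnadj x y h).elim,
      fun x y z h => (hnadj x y h).elim, fun x y h => (hnadj x y h).elim⟩,
      fun _ => (Nat.succ_pos _).trans_le ht₁, fun _ => (Nat.succ_pos _).trans_le ht₁⟩
  by_cases hcut : HasNoCutVertex H
  swap
  · simp only [HasNoCutVertex, not_forall] at hcut
    obtain ⟨v', x, ⟨x', hx⟩, y, ⟨y', hy⟩, hxv, hyv, hxy⟩ := hcut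
    let A : Set V := {z | ReachableIn H {v'}ᶜ x z}
    have hvA : v' ∉ A := fun h => h.mem_of_ne hxv rfl
    have hA : ∀ a b, H.Adj a b → a ∈ A → b ≠ v' → b ∈ A := fun a b hab ha hb =>
      ha.trans (ReachableIn.of_adj hab (by rintro rfl; exact hvA ha) hb)
    let H₁ : SimpleGraph V :=
      { Adj := fun a b => H.Adj a b ∧ (a ∈ A ∨ b ∈ A)
        symm := ⟨fun _ _ h => ⟨h.1.symm, h.2.symm⟩⟩
        loopless := ⟨fun _ h => h.1.ne rfl⟩ }
    let H₂ : SimpleGraph V :=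
      { Adj := fun a b => H.Adj a b ∧ a ∉ A ∧ b ∉ A
        symm := ⟨fun _ _ h => ⟨h.1.symm, h.2.symm⟩⟩
        loopless := ⟨fun _ h => h.1.ne rfl⟩ }
    have h₁ : H₁ < H := by
      refine lt_of_le_not_ge (fun a b h => h.1) fun hle => ?_
      rcases (hle hy).2 with h | h
      exacts [hxy h, hxy (hA y' y hy.symm h hyv)]
    have h₂ : H₂ < H :=
      lt_of_le_not_ge (fun a b h => h.1) fun hle => (hle hx).2.1 Relation.ReflTransGen.refl
    refine IsTotallyColorable.of_cut hvA hA (H₁ := H₁) (H₂ := H₂)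
      (fun a b hab h => ⟨hab, h⟩) (fun a b hab ha hb => ⟨hab, ha, hb⟩) (ih H₁ h₁) (ih H₂ h₂) ?_
    have := hd v'
    omega
  obtain ⟨r, hr⟩ := (H.degree_pos_iff_exists_adj v).1 (Nat.pos_of_ne_zero hv)
  have ht₂ := ht (hasCliqueMinor_degree_add_two hr fun x hx hxv =>
    hcut v r ⟨v, hr.symm⟩ x hx hr.ne' hxv)
  by_cases ht₃ : H.degree v + 3 ≤ t
  · exact (isTotallyColorable_of_edgeChoosability hd (hH H le_rfl)).mono ht₃
  by_cases hsmall : ∃ u, H.Adj v u ∧ H.degree u ≤ 2 ∧ 2 * H.degree u < t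
  · obtain ⟨u, hvu, hu, hut⟩ := hsmall
    refine IsTotallyColorable.of_deleteEdges hvu (ih _ ?_) hut (by omega)
    refine lt_of_le_not_ge (deleteEdges_le _) fun hle => ?_
    exact ((deleteEdges_adj ..).1 (hle hvu)).2 rfl
  have hlarge : ∀ u, H.Adj v u → H.degree u ≤ 2 → t ≤ 2 * H.degree u := by
    intro u hvu hu
    by_contra hlt
    exact hsmall ⟨u, hvu, hu, by omega⟩
  by_cases hbig : ∃ u, H.Adj v u ∧ H.degree u ≤ 2
  · obtain ⟨u, hvu, hu⟩ := hbig
    have := hlarge u hvu hu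
    have := hd u
    have hv2 : H.degree v = 2 := by omega
    obtain ⟨a, ha, b, hb, hab⟩ := one_lt_card.1 <| show 1 < #(H.neighborFinset v) by
      rw [card_neighborFinset_eq_degree]
      omega
    rw [mem_neighborFinset] at ha hb
    exact (isTotallyColorable_four (fun x => (hd x).trans hv2.le) hcut ha hb hab).mono (by omega)
  replace hbig : ∀ u, H.Adj v u → 3 ≤ H.degree u := by
    intro u hvu
    by_contra hlt
    exact hbig ⟨u, hvu, by omega⟩
  have hcard : ∀ u s, #(H.neighborFinset u \ s) + #s ≥ H.degree u := by
    intro u s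
    have := le_card_sdiff s (H.neighborFinset u)
    rw [card_neighborFinset_eq_degree] at this
    omega
  have hv3 := (hbig r hr).trans (hd r)
  obtain ⟨u, hu, hru, hreach⟩ := hcut.exists_neighbor hr <| by
    have := hcard v {r}
    rw [card_singleton] at this
    obtain ⟨u, hu⟩ := card_pos.1 (show 0 < #(H.neighborFinset v \ {r}) by omega)
    rw [mem_sdiff, mem_neighborFinset, mem_singleton] at hu
    exact ⟨u, hu⟩
  have hu3 := hbig u hu
  have := hcard u {v}
  rw [card_singleton] at this
  obtain ⟨w, hw, w', hw', hww'⟩ := one_lt_card.1 (show 1 < #(H.neighborFinset u \ {v}) by omega)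
  rw [mem_sdiff, mem_neighborFinset, mem_singleton] at hw hw'
  refine absurd (ht (hasCliqueMinor_degree_add_three hr hu hru hw.1 hw'.1 hww' hw.2 hw'.2 hreach ?_))
    ht₃
  intro x hx _
  have h1 := hcard x {v, u}
  have h2 := card_le_two (a := v) (b := u)
  have h3 := hbig x hx
  obtain ⟨z, hz⟩ := card_pos.1 (show 0 < #(H.neighborFinset x \ {v, u}) by omega)
  rw [mem_sdiff, mem_neighborFinset, mem_insert, mem_singleton, not_or] at hz
  exact ⟨z, hz⟩

theorem EdgeChoosable.of_iso {W : Type*} {G : SimpleGraph V} {H : SimpleGraph W} (f : G ≃g H)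
    {k : ℕ} (h : EdgeChoosable G k) : EdgeChoosable H k := by
  intro L hL
  have hmap : ∀ e ∈ H.edgeSet, e.map f.symm ∈ G.edgeSet := by
    intro e he
    induction e with
    | h x y => exact f.symm.map_adj_iff.2 he
  obtain ⟨c, hc, hcL⟩ := h (fun e => L (e.map f)) <| by
    intro e he
    refine hL _ ?_
    induction e with
    | h x y => exact f.map_adj_iff.2 he
  refine ⟨fun e => c (e.map f.symm), fun u v w huv huw hvw => ?_, fun e he => ?_⟩
  · exact hc (f.symm.map_adj_iff.2 huv) (f.symm.map_adj_iff.2 huw) (f.symm.injective.ne hvw)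
  · have := hcL _ (hmap e he)
    rw [Sym2.map_map] at this
    convert this
    induction e with
    | h x y => simp

theorem edgeChoosability_congr {W : Type*} {G : SimpleGraph V} {H : SimpleGraph W} (f : G ≃g H) :
    edgeChoosability G = edgeChoosability H :=
  congrArg sInf (Set.ext fun _ => ⟨fun h => h.of_iso f, fun h => h.of_iso f.symm⟩)

theorem exists_isProperEdgeColoring_of_iso {W : Type*} {G : SimpleGraph V} {H : SimpleGraph W}
    (f : G ≃g H) {k : ℕ} (h : ∃ c, IsProperEdgeColoring G c ∧ ∀ e ∈ G.edgeSet, c e < k) :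
    ∃ c, IsProperEdgeColoring H c ∧ ∀ e ∈ H.edgeSet, c e < k := by
  obtain ⟨c, hc, hck⟩ := h
  refine ⟨fun e => c (e.map f.symm), fun u v w huv huw hvw => ?_, fun e he => hck _ ?_⟩
  · exact hc (f.symm.map_adj_iff.2 huv) (f.symm.map_adj_iff.2 huw) (f.symm.injective.ne hvw)
  · induction e with
    | h x y => exact f.symm.map_adj_iff.2 he

theorem chromaticIndex_congr {W : Type*} {G : SimpleGraph V} {H : SimpleGraph W} (f : G ≃g H) :
    chromaticIndex G = chromaticIndex H :=
  congrArg sInf (Set.ext fun _ =>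
    ⟨exists_isProperEdgeColoring_of_iso f, exists_isProperEdgeColoring_of_iso f.symm⟩)

theorem chromaticNumber_totalGraph_le [Fintype V] (G : SimpleGraph V)
    (hG : ∀ H ≤ G, edgeChoosability H = chromaticIndex H) :
    (totalGraph G).chromaticNumber ≤ (hadwigerNumber (totalGraph G) : ℕ∞) := by
  refine Colorable.chromaticNumber_le ?_
  cases isEmpty_or_nonempty V
  · have : IsEmpty G.edgeSet := ⟨fun e => isEmptyElim e.1.out.1⟩
    exact Colorable.of_isEmpty _
  · refine (isTotallyColorable_of_not_hasCliqueMinor G hG fun h => ?_).colorable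
    have hbdd : BddAbove {t | HasCliqueMinor (totalGraph G) t} :=
      ⟨Nat.card (V ⊕ G.edgeSet), fun t ht => ht.le_card⟩
    exact (Nat.lt_succ_self _).not_ge (le_csSup hbdd h)

end Hadwiger

universe u

/-- if `F` is a class of simple finite graphs closed under taking subgraphs
on which the list coloring conjecture holds (`ch'(G) = χ'(G)`), then Hadwiger's conjecture
holds for the total graph of every member of `F`: `χ(T(G)) ≤ η(T(G))`. -/
theorem hadwiger_totalGraph_of_listColoringConjecture
    (F : ∀ {V : Type u}, SimpleGraph V → Prop)
    (hclosed : ∀ {V : Type u} [Fintype V] (G : SimpleGraph V),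
      F G → ∀ G' : G.Subgraph, F G'.coe)
    (hlcc : ∀ {V : Type u} [Fintype V] (G : SimpleGraph V),
      F G → edgeChoosability G = chromaticIndex G)
    {V : Type u} [Fintype V] (G : SimpleGraph V) (hG : F G) :
    (totalGraph G).chromaticNumber ≤ (hadwigerNumber (totalGraph G) : ℕ∞) := by
  refine chromaticNumber_totalGraph_le G fun H hle => ?_
  let e : (toSubgraph H hle).coe ≃g H :=
    { toFun := Subtype.val
      invFun := fun x => ⟨x, trivial⟩
      left_inv := fun _ => rfl
      right_inv := fun _ => rfl
      map_rel_iff' := Iff.rfl }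
  rw [← edgeChoosability_congr e, ← chromaticIndex_congr e]
  have := Fintype.ofFinite (toSubgraph H hle).verts
  exact hlcc _ (hclosed G hG _)
end

section
/- Let G be a simple finite graph with maximum degree Δ, let i ∈ {3,4,5}, and set A_i = {1,…,i−1}. Let π be a coloring of V(G) ∪ E(G) with colors from {1,…,Δ+3} such that π restricted to V(G) is a proper vertex coloring, π restricted to E(G) is a proper edge coloring, every edge e = uv with π(e) ∈ {π(u), π(v)} (a conflicting edge) has π(e) ∈ {3,4,5}, and no vertex colored 5 under π has edges of colors 3, 4, and 5 all incident on it. Let φ be a coloring of V(G) ∪ E(G) such that: (a) φ agrees with π on V(G); (b) φ restricted to E(G) is a proper edge coloring; (c) no edge colored by φ with a color in A_i has an endpoint of the same φ-color; (d) every edge with φ-color in A_i has π-color in {3,…,i}; (e) every edge with φ-color in A_i and π-color i has an endpoint of vertex-color i; (f) every edge e' with φ(e') ∈ {φ(u'), φ(v')} for its endpoints u',v' satisfies π(e') = φ(e') = i. Then for any edge e with φ(e) = i equal to the φ-color of one of its endpoints, there exists a coloring ψ of V(G) ∪ E(G) satisfying (a)–(f) in which e is not a conflicting edge (ψ(e)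 differs from the ψ-colors of both endpoints of e). -/
open SimpleGraph

/-- Conditions (c)–(f) on an edge coloring `g`, with colors in `{1, …, N}`: every condition
required of a recoloring except that `g` is a proper edge coloring. -/
structure IsAdmissible {V : Type*} (G : SimpleGraph V) (i N : ℕ) (pv : V → ℕ)
    (pe g : Sym2 V → ℕ) : Prop where
  range : ∀ e ∈ G.edgeSet, g e ∈ Finset.Icc 1 N
  not_conflict : ∀ ⦃u v⦄, G.Adj u v → g s(u, v) ∈ Finset.Ico 1 i →
    g s(u, v) ≠ pv u ∧ g s(u, v) ≠ pv v
  mem_Icc : ∀ ⦃u v⦄, G.Adj u v → g s(u, v) ∈ Finset.Ico 1 i → pe s(u, v) ∈ Finset.Icc 3 i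
  endpoint : ∀ ⦃u v⦄, G.Adj u v → g s(u, v) ∈ Finset.Ico 1 i → pe s(u, v) = i →
    pv u = i ∨ pv v = i
  conflict : ∀ ⦃u v⦄, G.Adj u v → g s(u, v) = pv u ∨ g s(u, v) = pv v →
    pe s(u, v) = i ∧ g s(u, v) = i

/-- Recoloring one edge with a small color different from the colors of its endpoints
preserves admissibility. -/
theorem IsAdmissible.update {V : Type*} [DecidableEq V] {G : SimpleGraph V} {i N : ℕ}
    {pv : V → ℕ} {pe g : Sym2 V → ℕ} (hg : IsAdmissible G i N pv pe g) (hiN : i ≤ N)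
    {a b : V} {c : ℕ} (hc : c ∈ Finset.Ico 1 i) (hca : c ≠ pv a) (hcb : c ≠ pv b)
    (hpe : pe s(a, b) ∈ Finset.Icc 3 i) (hend : pe s(a, b) = i → pv a = i ∨ pv b = i) :
    IsAdmissible G i N pv pe (Function.update g s(a, b) c) := by
  have key : ∀ u v : V, s(u, v) = s(a, b) →
      (c ≠ pv u ∧ c ≠ pv v) ∧ (pe s(u, v) = i → pv u = i ∨ pv v = i) := by
    intro u v h
    rw [h]
    rcases Sym2.eq_iff.1 h with ⟨rfl, rfl⟩ | ⟨rfl, rfl⟩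
    · exact ⟨⟨hca, hcb⟩, hend⟩
    · exact ⟨⟨hcb, hca⟩, fun h => (hend h).symm⟩
  constructor
  · intro e he
    by_cases h : e = s(a, b)
    · subst h
      rw [Function.update_self]
      simp only [Finset.mem_Ico, Finset.mem_Icc] at hc ⊢
      omega
    · rw [Function.update_of_ne h]
      exact hg.range e he
  · intro u v huv
    by_cases h : s(u, v) = s(a, b)
    · rw [h, Function.update_self]
      exact fun _ => (key u v h).1
    · rw [Function.update_of_ne h]
      exact hg.not_conflict huv
  · intro u v huv
    by_cases h : s(u, v) = s(a, b)
    · rw [h]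
      exact fun _ => hpe
    · rw [Function.update_of_ne h]
      exact hg.mem_Icc huv
  · intro u v huv
    by_cases h : s(u, v) = s(a, b)
    · exact fun _ => (key u v h).2
    · rw [Function.update_of_ne h]
      exact hg.endpoint huv
  · intro u v huv
    by_cases h : s(u, v) = s(a, b)
    · rw [h, Function.update_self]
      exact fun h' => absurd h' (not_or.2 (key u v h).1)
    · rw [Function.update_of_ne h]
      exact hg.conflict huv

/-- At every vertex `z` some color of `{1, …, i-1}` differs from the color of `z` and from the
colors of all edges at `z` whose original color is not `i`. -/
theorem IsAdmissible.exists_free_color {V : Type*} [Fintype V] {G : SimpleGraph V} {i N : ℕ}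
    {pv : V → ℕ} {pe g : Sym2 V → ℕ} (hg : IsAdmissible G i N pv pe g) (hi : 3 ≤ i)
    (hpeProper : ∀ ⦃u v w⦄, G.Adj u v → G.Adj u w → v ≠ w → pe s(u, v) ≠ pe s(u, w)) (z : V) :
    ∃ c ∈ Finset.Ico 1 i, c ≠ pv z ∧ ∀ w, G.Adj z w → pe s(z, w) ≠ i → g s(z, w) ≠ c := by
  classical
  set S : Finset V := Finset.univ.filter fun w =>
    G.Adj z w ∧ g s(z, w) ∈ Finset.Ico 1 i ∧ pe s(z, w) ≠ i with hS
  have hScard : S.card ≤ (Finset.Ico 3 i).card := by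
    refine Finset.card_le_card_of_injOn (fun w => pe s(z, w)) ?_ ?_
    · intro w hw
      obtain ⟨h₁, h₂, h₃⟩ := (Finset.mem_filter.1 hw).2
      have := hg.mem_Icc h₁ h₂
      simp only [Finset.mem_Icc, Finset.coe_Ico, Set.mem_Ico] at this ⊢
      omega
    · intro w hw w' hw' h
      by_contra hne
      exact hpeProper (Finset.mem_filter.1 hw).2.1 (Finset.mem_filter.1 hw').2.1 hne h
  have hlt : (insert (pv z) (S.image fun w => g s(z, w))).card < (Finset.Ico 1 i).card := by
    have h₁ := Finset.card_insert_le (pv z) (S.image fun w => g s(z, w))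
    have h₂ : (S.image fun w => g s(z, w)).card ≤ S.card := Finset.card_image_le
    simp only [Nat.card_Ico] at hScard ⊢
    omega
  obtain ⟨c, hc, hcn⟩ := Finset.exists_mem_notMem_of_card_lt_card hlt
  rw [Finset.mem_insert, not_or] at hcn
  refine ⟨c, hc, hcn.1, fun w hw hwi hwc => hcn.2 ?_⟩
  exact Finset.mem_image.2 ⟨w, by simp [hS, hw, hwi, hwc, Finset.mem_Ico.1 hc], hwc⟩

/-- If two distinct edges at `x` have the same color after the edge `ab` gets color `d`, then
either one of them is `ab` and the other had color `d`, or neither is `ab`. -/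
theorem update_eq_update_cases {V α : Type*} [DecidableEq V] {g : Sym2 V → α} {a b x y w : V}
    {d : α} (hne : y ≠ w)
    (h : Function.update g s(a, b) d s(x, y) = Function.update g s(a, b) d s(x, w)) :
    (∃ t, t ≠ b ∧ x = a ∧ (y = b ∧ w = t ∨ w = b ∧ y = t) ∧ g s(a, t) = d) ∨
    (∃ t, t ≠ a ∧ x = b ∧ (y = a ∧ w = t ∨ w = a ∧ y = t) ∧ g s(b, t) = d) ∨
    (s(x, y) ≠ s(a, b) ∧ s(x, w) ≠ s(a, b) ∧ g s(x, y) = g s(x, w)) := by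
  by_cases hy : s(x, y) = s(a, b) <;> by_cases hw : s(x, w) = s(a, b)
  · exact absurd (Sym2.congr_right.1 (hy.trans hw.symm)) hne
  · rw [hy, Function.update_self, Function.update_of_ne hw] at h
    rcases Sym2.eq_iff.1 hy with ⟨rfl, rfl⟩ | ⟨rfl, rfl⟩
    · exact Or.inl ⟨w, hne.symm, rfl, Or.inl ⟨rfl, rfl⟩, h.symm⟩
    · exact Or.inr (Or.inl ⟨w, hne.symm, rfl, Or.inl ⟨rfl, rfl⟩, h.symm⟩)
  · rw [hw, Function.update_self, Function.update_of_ne hy] at h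
    rcases Sym2.eq_iff.1 hw with ⟨rfl, rfl⟩ | ⟨rfl, rfl⟩
    · exact Or.inl ⟨y, hne, rfl, Or.inr ⟨rfl, rfl⟩, h⟩
    · exact Or.inr (Or.inl ⟨y, hne, rfl, Or.inr ⟨rfl, rfl⟩, h⟩)
  · rw [Function.update_of_ne hy, Function.update_of_ne hw] at h
    exact Or.inr (Or.inr ⟨hy, hw, h⟩)

/-- If the only failure of properness of an admissible coloring is that an `i`-vertex `u` has
a second edge of the same color `c` as its edge `uv` of original color `i`, then the failure
can be repaired while the edges of original color `i` and of color `c` keep color `c`: either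
the second edge can be recolored directly, or its color is exchanged with that of an adjacent
edge of original color `i`, which moves the failure to another `i`-vertex. -/
theorem IsAdmissible.exists_proper {V : Type*} [Fintype V] {G : SimpleGraph V} {i N : ℕ}
    {pv : V → ℕ} {pe : Sym2 V → ℕ} (hi : 3 ≤ i) (hiN : i ≤ N)
    (hpvProper : ∀ ⦃u v⦄, G.Adj u v → pv u ≠ pv v)
    (hpeProper : ∀ ⦃u v w⦄, G.Adj u v → G.Adj u w → v ≠ w → pe s(u, v) ≠ pe s(u, w))
    (hdeg : ∀ ⦃u a b d⦄, pv u = i → G.Adj u a → G.Adj u b → G.Adj u d → a ≠ b → a ≠ d → b ≠ d →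
      pe s(u, a) ∈ Finset.Icc 3 i → pe s(u, b) ∈ Finset.Icc 3 i → pe s(u, d) ∉ Finset.Icc 3 i)
    {c : ℕ} (hc : c ∈ Finset.Ico 1 i) {g : Sym2 V → ℕ} (hg : IsAdmissible G i N pv pe g)
    {u v : V} (huv : G.Adj u v) (hu : pv u = i) (hpuv : pe s(u, v) = i) (hguv : g s(u, v) = c)
    (hproper : ∀ ⦃x y w⦄, G.Adj x y → G.Adj x w → y ≠ w → g s(x, y) = g s(x, w) →
      x = u ∧ (y = v ∨ w = v)) :
    ∃ ge, IsAdmissible G i N pv pe ge ∧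
      (∀ ⦃x y w⦄, G.Adj x y → G.Adj x w → y ≠ w → ge s(x, y) ≠ ge s(x, w)) ∧
      ∀ e, pe e = i → g e = c → ge e = c := by
  classical
  induction hn : (Finset.univ.filter fun e : Sym2 V => pe e = i ∧ g e ≠ c).card
    using Nat.strong_induction_on generalizing g u v with
  | _ n ih =>
  subst hn
  by_cases hz : ∃ z, z ≠ v ∧ G.Adj u z ∧ g s(u, z) = c
  swap
  · refine ⟨g, hg, fun x y w hy hw hne h => ?_, fun _ _ h => h⟩
    obtain ⟨rfl, rfl | rfl⟩ := hproper hy hw hne h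
    · exact hz ⟨w, hne.symm, hw, by rw [← h, hguv]⟩
    · exact hz ⟨y, hne, hy, by rw [h, hguv]⟩
  obtain ⟨z, hzv, huz, hguz⟩ := hz
  have hpuz : pe s(u, z) ≠ i := hpuv ▸ hpeProper huz huv hzv
  have hne_uz : ∀ ⦃e⦄, pe e = i → e ≠ s(u, z) := by
    rintro _ he rfl
    exact hpuz he
  have hzu : z ≠ u := huz.ne'
  have hgzu : g s(z, u) = c := by rw [Sym2.eq_swap, hguz]
  have hpuz' := hg.mem_Icc huz (hguz ▸ hc)
  have hcz : c ≠ pv z := hguz ▸ (hg.not_conflict huz (hguz ▸ hc)).2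
  have hsmall : ∀ w, G.Adj u w → w ≠ z → w ≠ v → g s(u, w) ∉ Finset.Ico 1 i := by
    intro w hw hwz hwv hgw
    exact hdeg hu huv huz hw hzv.symm hwv.symm hwz.symm (hg.mem_Icc huv (hguv ▸ hc)) hpuz'
      (hg.mem_Icc hw hgw)
  have hzproper : ∀ ⦃y w⦄, G.Adj z y → G.Adj z w → y ≠ w → g s(z, y) ≠ g s(z, w) :=
    fun y w hy hw hne h => hzu (hproper hy hw hne h).1
  have hother : ∀ ⦃x y w⦄, G.Adj x y → G.Adj x w → y ≠ w → s(x, y) ≠ s(u, z) →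
      s(x, w) ≠ s(u, z) → g s(x, y) ≠ g s(x, w) := by
    intro x y w hy hw hne hyz hwz h
    obtain ⟨rfl, rfl | rfl⟩ := hproper hy hw hne h
    · exact hsmall w hw (fun h' => hwz (by rw [h'])) hne.symm (by rw [← h, hguv]; exact hc)
    · exact hsmall y hy (fun h' => hyz (by rw [h'])) hne (by rw [h, hguv]; exact hc)
  have hu_ne : ∀ ⦃d t⦄, d ∈ Finset.Ico 1 i → d ≠ c → G.Adj u t → t ≠ z → g s(u, t) ≠ d := by
    intro d t hd hdc ht htz h
    by_cases htv : t = v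
    · exact hdc (by rw [← h, htv, hguv])
    · exact hsmall t ht htz htv (h ▸ hd)
  by_cases hy : ∃ y, G.Adj z y ∧ pe s(z, y) = i ∧ g s(z, y) ∈ Finset.Ico 1 i
  · obtain ⟨y, hzy, hpzy, hgzy⟩ := hy
    have hyu : y ≠ u := by
      rintro rfl
      exact hpuz (by rw [Sym2.eq_swap, hpzy])
    have hpvy : pv y = i :=
      (hg.endpoint hzy hgzy hpzy).resolve_left fun h => hpvProper huz (hu.trans h.symm)
    have hdc : g s(z, y) ≠ c := hgzu ▸ hzproper hzy huz.symm hyu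
    have hdz := (hg.not_conflict hzy hgzy).1
    set d := g s(z, y)
    have hi_ne : ∀ x ∈ Finset.Ico 1 i, x ≠ i := fun x hx => (Finset.mem_Ico.1 hx).2.ne
    have hg₁ : IsAdmissible G i N pv pe (Function.update g s(u, z) d) :=
      hg.update hiN hgzy (hu ▸ hi_ne d hgzy) hdz hpuz' fun h => absurd h hpuz
    have hg₂ : IsAdmissible G i N pv pe
        (Function.update (Function.update g s(u, z) d) s(z, y) c) :=
      hg₁.update hiN hc hcz (hpvy ▸ hi_ne c hc) (hg.mem_Icc hzy hgzy) fun _ => Or.inr hpvy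
    have hkeep : ∀ e, pe e = i → g e = c →
        Function.update (Function.update g s(u, z) d) s(z, y) c e = c := by
      intro e he hec
      by_cases h : e = s(z, y)
      · rw [h, Function.update_self]
      · rw [Function.update_of_ne h, Function.update_of_ne (hne_uz he), hec]
    refine (ih _ (Finset.card_lt_card ?_) hg₂ hzy.symm hpvy (by rw [Sym2.eq_swap, hpzy])
      (by rw [Sym2.eq_swap (a := y), Function.update_self]) ?_ rfl).imp fun ge h =>
        ⟨h.1, h.2.1, fun e he hec => h.2.2 e he (hkeep e he hec)⟩
    · refine (Finset.ssubset_iff_of_subset ?_).2 ⟨s(z, y), ?_, ?_⟩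
      · intro e he
        simp only [Finset.mem_filter, Finset.mem_univ, true_and] at he ⊢
        exact ⟨he.1, fun h => he.2 (hkeep e he.1 h)⟩
      · simpa [hpzy] using hdc
      · simp
    · intro x p w hp hw hne h
      rcases update_eq_update_cases hne h with
        ⟨t, hty, rfl, ht, hgt⟩ | ⟨t, -, rfl, ht, -⟩ | ⟨hpzy', hwzy', h⟩
      · exfalso
        by_cases htu : t = u
        · rw [htu, Sym2.eq_swap, Function.update_self] at hgt
          exact hdc hgt
        · have hxt : G.Adj x t := by rcases ht with ⟨-, rfl⟩ | ⟨-, rfl⟩ <;> assumption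
          have hne' : s(x, t) ≠ s(u, x) := by
            rw [Sym2.eq_swap (a := u)]
            exact fun h => htu (Sym2.congr_right.1 h)
          rw [Function.update_of_ne hne'] at hgt
          exact hzproper hxt huz.symm htu (hgt.trans hgzu.symm)
      · exact ⟨rfl, ht.imp And.left And.left⟩
      · exfalso
        rcases update_eq_update_cases hne h with
          ⟨t, htz, rfl, ht, hgt⟩ | ⟨t, htu, rfl, ht, hgt⟩ | ⟨hp', hw', h⟩
        · have hxt : G.Adj x t := by rcases ht with ⟨-, rfl⟩ | ⟨-, rfl⟩ <;> assumption
          exact hu_ne hgzy hdc hxt htz hgt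
        · have hxt : G.Adj x t ∧ t ≠ y := by
            rcases ht with ⟨-, rfl⟩ | ⟨-, rfl⟩
            · exact ⟨hw, fun h => hwzy' (by rw [h])⟩
            · exact ⟨hp, fun h => hpzy' (by rw [h])⟩
          exact hzproper hxt.1 hzy hxt.2 hgt
        · exact hother hp hw hne hp' hw' h
  · obtain ⟨d, hd, hdz, hfree⟩ := hg.exists_free_color hi hpeProper z
    have hdc : d ≠ c := fun h =>
      hfree u huz.symm (by rwa [Sym2.eq_swap]) (hgzu.trans h.symm)
    have hdu : d ≠ pv u := hu ▸ (Finset.mem_Ico.1 hd).2.ne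
    refine ⟨_, hg.update hiN hd hdu hdz hpuz' fun h => absurd h hpuz,
      fun x p w hp hw hne h => ?_, fun e he hec => ?_⟩
    · rcases update_eq_update_cases hne h with
        ⟨t, htz, rfl, ht, hgt⟩ | ⟨t, htu, rfl, ht, hgt⟩ | ⟨hp', hw', h⟩
      · have hxt : G.Adj x t := by rcases ht with ⟨-, rfl⟩ | ⟨-, rfl⟩ <;> assumption
        exact hu_ne hd hdc hxt htz hgt
      · have hxt : G.Adj x t := by rcases ht with ⟨-, rfl⟩ | ⟨-, rfl⟩ <;> assumption
        by_cases hpi : pe s(x, t) = i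
        · exact hy ⟨t, hxt, hpi, hgt ▸ hd⟩
        · exact hfree t hxt hpi hgt
      · exact hother hp hw hne hp' hw' h
    · rw [Function.update_of_ne (hne_uz he), hec]

/-- the recoloring lemma: with colors taken from `{1, …, Δ+3}` and
`A_i = {1, …, i-1}` for `i ∈ {3,4,5}`, given the original coloring `π` (proper on vertices
and edges, with all conflicting edges colored in `{3,4,5}`, and no `5`-colored vertex seeing
edge colors `3`, `4`, and `5` simultaneously) and a coloring `φ` agreeing with `π` on
vertices (its vertex coloring is `πv`) and satisfying conditions (b)–(f), any conflicting
`i`-edge `e = u₀v₀` (with `φ(e) = i` equal to the `φ`-color of one of its endpoints) can be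
recolored: there is a coloring `ψ` (with vertex coloring `πv`, condition (a)) satisfying
(b)–(f) in which `e` is no longer conflicting. -/
theorem recoloring_lemma {V : Type*} [Fintype V] (G : SimpleGraph V) [DecidableRel G.Adj]
    (i : ℕ) (hi : i ∈ ({3, 4, 5} : Set ℕ))
    (pv : V → ℕ) (pe : Sym2 V → ℕ)
    -- π uses colors from {1, …, Δ+3}
    (hpvRange : ∀ v : V, pv v ∈ Finset.Icc 1 (G.maxDegree + 3))
    (hpeRange : ∀ e ∈ G.edgeSet, pe e ∈ Finset.Icc 1 (G.maxDegree + 3))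
    -- π is proper on vertices and on edges
    (hpvProper : ∀ ⦃u v⦄, G.Adj u v → pv u ≠ pv v)
    (hpeProper : ∀ ⦃u v w⦄, G.Adj u v → G.Adj u w → v ≠ w → pe s(u, v) ≠ pe s(u, w))
    -- every conflicting edge of π has color in {3,4,5}
    (hpConf : ∀ ⦃u v⦄, G.Adj u v → pe s(u, v) = pv u ∨ pe s(u, v) = pv v →
      pe s(u, v) ∈ ({3, 4, 5} : Set ℕ))
    -- Property A: no 5-vertex has a 3-edge, a 4-edge and a 5-edge all incident on it
    (hPropA : ∀ v : V, pv v = 5 →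
      ¬ ((∃ a, G.Adj v a ∧ pe s(v, a) = 3) ∧ (∃ a, G.Adj v a ∧ pe s(v, a) = 4) ∧
          (∃ a, G.Adj v a ∧ pe s(v, a) = 5)))
    -- the current coloring φ: (a) it agrees with π on vertices, so only its edge part
    -- `fe` is quantified, with vertex part `pv`
    (fe : Sym2 V → ℕ)
    (hfeRange : ∀ e ∈ G.edgeSet, fe e ∈ Finset.Icc 1 (G.maxDegree + 3))
    -- (b) φ is a proper edge coloring
    (hb : ∀ ⦃u v w⦄, G.Adj u v → G.Adj u w → v ≠ w → fe s(u, v) ≠ fe s(u, w))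
    -- (c) no conflicting A_i-edges
    (hc : ∀ ⦃u v⦄, G.Adj u v → fe s(u, v) ∈ Finset.Ico 1 i →
      fe s(u, v) ≠ pv u ∧ fe s(u, v) ≠ pv v)
    -- (d) every A_i-edge has original color in {3, …, i}
    (hd : ∀ ⦃u v⦄, G.Adj u v → fe s(u, v) ∈ Finset.Ico 1 i →
      pe s(u, v) ∈ Finset.Icc 3 i)
    -- (e) every A_i-edge of original color i has an endpoint colored i
    (he : ∀ ⦃u v⦄, G.Adj u v → fe s(u, v) ∈ Finset.Ico 1 i → pe s(u, v) = i →
      pv u = i ∨ pv v = i)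
    -- (f) every conflicting edge of φ has original color i and φ-color i
    (hf : ∀ ⦃u v⦄, G.Adj u v → fe s(u, v) = pv u ∨ fe s(u, v) = pv v →
      pe s(u, v) = i ∧ fe s(u, v) = i)
    -- e = u₀v₀ is a conflicting i-edge of φ
    (u₀ v₀ : V) (hadj : G.Adj u₀ v₀) (hei : fe s(u₀, v₀) = i)
    (hconf : pv u₀ = i ∨ pv v₀ = i) :
    ∃ ge : Sym2 V → ℕ,
      (∀ e ∈ G.edgeSet, ge e ∈ Finset.Icc 1 (G.maxDegree + 3)) ∧
      (∀ ⦃u v w⦄, G.Adj u v → G.Adj u w → v ≠ w → ge s(u, v) ≠ ge s(u, w)) ∧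
      (∀ ⦃u v⦄, G.Adj u v → ge s(u, v) ∈ Finset.Ico 1 i →
        ge s(u, v) ≠ pv u ∧ ge s(u, v) ≠ pv v) ∧
      (∀ ⦃u v⦄, G.Adj u v → ge s(u, v) ∈ Finset.Ico 1 i →
        pe s(u, v) ∈ Finset.Icc 3 i) ∧
      (∀ ⦃u v⦄, G.Adj u v → ge s(u, v) ∈ Finset.Ico 1 i → pe s(u, v) = i →
        pv u = i ∨ pv v = i) ∧
      (∀ ⦃u v⦄, G.Adj u v → ge s(u, v) = pv u ∨ ge s(u, v) = pv v →
        pe s(u, v) = i ∧ ge s(u, v) = i) ∧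
      ge s(u₀, v₀) ≠ pv u₀ ∧ ge s(u₀, v₀) ≠ pv v₀ := by
  classical
  have hi' : i = 3 ∨ i = 4 ∨ i = 5 := hi
  wlog hu : pv u₀ = i generalizing u₀ v₀
  · obtain ⟨ge, h₁, h₂, h₃, h₄, h₅, h₆, h₇, h₈⟩ := this v₀ u₀ hadj.symm
      (by rw [Sym2.eq_swap, hei]) hconf.symm (hconf.resolve_left hu)
    rw [Sym2.eq_swap] at h₇ h₈
    exact ⟨ge, h₁, h₂, h₃, h₄, h₅, h₆, h₈, h₇⟩
  have hpe₀ : pe s(u₀, v₀) = i := (hf hadj (Or.inl (hei.trans hu.symm))).1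
  have hiN : i ≤ G.maxDegree + 3 := hei ▸ (Finset.mem_Icc.1 (hfeRange _ hadj)).2
  have hi3 : 3 ≤ i := by omega
  have hdeg : ∀ ⦃u a b d⦄, pv u = i → G.Adj u a → G.Adj u b → G.Adj u d → a ≠ b → a ≠ d →
      b ≠ d → pe s(u, a) ∈ Finset.Icc 3 i → pe s(u, b) ∈ Finset.Icc 3 i →
      pe s(u, d) ∉ Finset.Icc 3 i := by
    intro u a b d hui ha hb hd hab had hbd hpa hpb hpd
    have h₁ := hpeProper ha hb hab
    have h₂ := hpeProper ha hd had
    have h₃ := hpeProper hb hd hbd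
    rw [Finset.mem_Icc] at hpa hpb hpd
    have hi5 : i = 5 := by omega
    have hall : ∀ k ∈ Finset.Icc 3 5, ∃ t, G.Adj u t ∧ pe s(u, t) = k := by
      intro k hk
      rw [Finset.mem_Icc] at hk
      have : pe s(u, a) = k ∨ pe s(u, b) = k ∨ pe s(u, d) = k := by omega
      rcases this with h | h | h
      exacts [⟨a, ha, h⟩, ⟨b, hb, h⟩, ⟨d, hd, h⟩]
    exact hPropA u (hui.trans hi5) ⟨hall 3 (by decide), hall 4 (by decide), hall 5 (by decide)⟩
  have hφ : IsAdmissible G i (G.maxDegree + 3) pv pe fe := ⟨hfeRange, hc, hd, he, hf⟩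
  obtain ⟨c, hcA, hcv, hfree⟩ := hφ.exists_free_color hi3 hpeProper v₀
  have hcu : c ≠ pv u₀ := hu ▸ (Finset.mem_Ico.1 hcA).2.ne
  have hg : IsAdmissible G i (G.maxDegree + 3) pv pe (Function.update fe s(u₀, v₀) c) :=
    hφ.update hiN hcA hcu hcv (by rw [hpe₀]; exact Finset.mem_Icc.2 ⟨hi3, le_rfl⟩)
      fun _ => Or.inl hu
  obtain ⟨ge, hge, hgeProper, hkeep⟩ := hg.exists_proper hi3 hiN hpvProper hpeProper hdeg hcA
    hadj hu hpe₀ (Function.update_self ..) <| by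
      intro x y w hy hw hne h
      rcases update_eq_update_cases hne h with
        ⟨t, -, rfl, ht, -⟩ | ⟨t, htu, rfl, ht, hgt⟩ | ⟨-, -, h⟩
      · exact ⟨rfl, ht.imp And.left And.left⟩
      · have hxt : G.Adj x t := by rcases ht with ⟨-, rfl⟩ | ⟨-, rfl⟩ <;> assumption
        refine absurd hgt (hfree t hxt ?_)
        rw [← hpe₀, Sym2.eq_swap (a := u₀)]
        exact hpeProper hxt hadj.symm htu
      · exact absurd h (hb hy hw hne)
  have hge₀ : ge s(u₀, v₀) = c := hkeep _ hpe₀ (Function.update_self ..)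
  exact ⟨ge, hge.range, hgeProper, hge.not_conflict, hge.mem_Icc, hge.endpoint, hge.conflict,
    hge₀ ▸ hcu, hge₀ ▸ hcv⟩
end
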